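/- Let A(X; 3, 4) denote the number of squarefree integers d with d ≡ 3 (mod 4), 1 < 2d ≤ X, and such that every prime p dividing d satisfies (2/p) = 1. Then A(X; 3, 4) ~ (C₂/6)·X/√(log X) as X → ∞, where C₂ = (1/√π)·lim_{s→1⁺} ( √(s−1) · ∏_{p ∈ P₂} (1 + p^{−s}) ) and P₂ is the set of primes p such that p = 2 or (2/p) = 1. -/

import Mathlib

open Filter Asymptotics

/-- `A(X; 3, 4)`: the number of squarefree `d ≡ 3 (mod 4)` with `1 < 2d ≤ X` all of whose
prime divisors `p` satisfy `(2/p) = 1`. -/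
noncomputable def Acount (X : ℝ) : ℕ :=
  Nat.card {d : ℕ | Squarefree d ∧ d % 4 = 3 ∧ 1 < 2 * d ∧ (2 * d : ℝ) ≤ X ∧
    ∀ p : ℕ, p.Prime → p ∣ d → jacobiSym 2 p = 1}

section partA
open Filter Asymptotics MeasureTheory Set Topology

noncomputable def fejK (u : ℝ) : ℝ := 2 * (1 - Real.cos u) / u ^ 2
noncomputable def fejW (y : ℝ) : ℝ := max 0 (1 - |y|)

lemma fejK_nonneg (u : ℝ) : 0 ≤ fejK u := by
  unfold fejK
  have := Real.cos_le_one u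
  apply div_nonneg <;> nlinarith [sq_nonneg u]

lemma fejK_le (u : ℝ) : fejK u ≤ 5 * (1 + u ^ 2)⁻¹ := by
  unfold fejK
  rcases eq_or_ne u 0 with h | h
  · subst h; norm_num
  · have h1 := Real.one_sub_sq_div_two_le_cos (x := u)
    have h2 := Real.neg_one_le_cos u
    have hu : 0 < u ^ 2 := by positivity
    rw [← div_eq_mul_inv, div_le_div_iff₀ hu (by positivity)]
    nlinarith

lemma fejK_measurable : Measurable fejK := by
  unfold fejK; fun_prop

lemma fejK_integrable : Integrable fejK := by
  refine Integrable.mono' (integrable_inv_one_add_sq.const_mul 5) fejK_measurable.aestronglyMeasurable ?_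
  filter_upwards with u
  rw [Real.norm_of_nonneg (fejK_nonneg u)]
  exact fejK_le u

lemma fejK_integral_pos : 0 < ∫ u, fejK u := by
  rw [integral_pos_iff_support_of_nonneg fejK_nonneg fejK_integrable]
  refine lt_of_lt_of_le ?_ (measure_mono (show Ioo (0:ℝ) 1 ⊆ _ from ?_))
  · simp
  · intro u hu
    have : Real.cos u < 1 := by
      have := Real.cos_lt_cos_of_nonneg_of_le_pi (x := 0) (y := u) le_rfl (by linarith [Real.pi_gt_three, hu.2]) hu.1
      simpa using this
    have hu0 : u ≠ 0 := hu.1.ne'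
    simp only [Function.mem_support, fejK]
    have : 1 - Real.cos u ≠ 0 := by linarith
    positivity

lemma fejW_continuous : Continuous fejW := by unfold fejW; fun_prop

lemma fejW_support : HasCompactSupport fejW := by
  apply HasCompactSupport.intro (isCompact_Icc (a := (-1:ℝ)) (b := 1))
  intro x hx
  unfold fejW
  apply max_eq_left
  by_contra h
  push Not at h
  exact hx (abs_le.1 (by linarith))

lemma fejW_integrable : Integrable fejW := fejW_continuous.integrable_of_hasCompactSupport fejW_support

lemma fejW_fourier (u : ℝ) (hu : u ≠ 0) :
    ∫ y, (fejW y : ℂ) * Complex.exp (Complex.I * u * y) = fejK u := by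
  have hs : Function.support (fun y : ℝ => (fejW y : ℂ) * Complex.exp (Complex.I * u * y)) ⊆ Ioc (-1) 1 := by
    intro y hy
    by_contra h
    apply hy
    have : fejW y = 0 := by
      unfold fejW
      apply max_eq_left
      by_contra h'
      push Not at h'
      have := abs_lt.1 (show |y| < 1 by linarith)
      exact h ⟨this.1, this.2.le⟩
    simp [this]
  rw [← intervalIntegral.integral_eq_integral_of_support_subset hs]
  have hc : Continuous (fun y : ℝ => (fejW y : ℂ) * Complex.exp (Complex.I * u * y)) := by
    have := fejW_continuous
    fun_prop
  rw [← intervalIntegral.integral_add_adjacent_intervals (b := 0) (hc.intervalIntegrable _ _) (hc.intervalIntegrable _ _)]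
  have huC : (u:ℂ) ≠ 0 := by exact_mod_cast hu
  have hI : Complex.I * u ≠ 0 := mul_ne_zero Complex.I_ne_zero huC
  have key : ∀ e : ℝ, ∀ y : ℝ, HasDerivAt (fun y : ℝ => ((1 + e * y) / (Complex.I * u) + e / u ^ 2) * Complex.exp (Complex.I * u * y))
      (((1 + e * y : ℝ) : ℂ) * Complex.exp (Complex.I * u * y)) y := by
    intro e y
    have h1 : HasDerivAt (fun y : ℝ => ((1 + e * y) / (Complex.I * u) + e / u ^ 2 : ℂ)) (e / (Complex.I * u)) y := by
      have := (((Complex.ofRealCLM.hasDerivAt (x := y)).const_mul (e:ℂ)).const_add 1).div_const (Complex.I * u) |>.add_const ((e:ℂ) / u ^ 2)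
      simpa using this
    have h2 : HasDerivAt (fun y : ℝ => Complex.exp (Complex.I * u * y)) (Complex.exp (Complex.I * u * y) * (Complex.I * u)) y := by
      have := ((Complex.ofRealCLM.hasDerivAt (x := y)).const_mul (Complex.I * u)).cexp
      simpa using this
    convert! h1.mul h2 using 1
    push_cast
    field_simp
    linear_combination (-(e:ℂ)) * Complex.I_sq
  have i1 : ∫ y in (-1:ℝ)..0, (fejW y : ℂ) * Complex.exp (Complex.I * u * y) = 
     ∫ y in (-1:ℝ)..0, (((1 + 1 * y : ℝ) : ℂ) * Complex.exp (Complex.I * u * y)) := by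
    apply intervalIntegral.integral_congr
    intro y hy
    rw [uIcc_of_le (by norm_num)] at hy
    simp only
    congr 2
    unfold fejW
    rw [abs_of_nonpos hy.2, max_eq_right] <;> linarith [hy.1]
  have i2 : ∫ y in (0:ℝ)..1, (fejW y : ℂ) * Complex.exp (Complex.I * u * y) = 
     ∫ y in (0:ℝ)..1, (((1 + (-1) * y : ℝ) : ℂ) * Complex.exp (Complex.I * u * y)) := by
    apply intervalIntegral.integral_congr
    intro y hy
    rw [uIcc_of_le (by norm_num)] at hy
    simp only
    congr 2
    unfold fejW
    rw [abs_of_nonneg hy.1, max_eq_right] <;> linarith [hy.2]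
  rw [i1, i2, intervalIntegral.integral_eq_sub_of_hasDerivAt (fun y _ => key 1 y) (Continuous.intervalIntegrable (by fun_prop) _ _),
    intervalIntegral.integral_eq_sub_of_hasDerivAt (fun y _ => key (-1) y) (Continuous.intervalIntegrable (by fun_prop) _ _)]
  unfold fejK
  push_cast
  rw [Complex.cos]
  simp only [mul_zero, Complex.exp_zero]
  rw [show Complex.I * (u:ℂ) * (-1) = -u * Complex.I by ring, show Complex.I * (u:ℂ) * 1 = u * Complex.I by ring]
  field_simp
  ring

end partA

section partB
open Filter Asymptotics MeasureTheory Set Topology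

lemma fejW_nonneg (y : ℝ) : 0 ≤ fejW y := le_max_left _ _

lemma fej_fubini (S : ℝ → ℝ) (M A : ℝ) (hS : Measurable S) (hSM : ∀ t, |S t - A| ≤ M)
    (G : ℂ → ℂ)
    (hGL : ∀ s : ℂ, 0 < s.re → G s = ∫ t in Ioi (0:ℝ), ((S t - A : ℝ) : ℂ) * Complex.exp (-s * t))
    (l u σ : ℝ) (hl : 0 < l) (hσ : 0 < σ) :
    ∫ t in Ioi (0:ℝ), (((S t - A) * Real.exp (-σ * t) * fejK (l * (u - t)) : ℝ) : ℂ) =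
      ∫ y, (fejW y : ℂ) * Complex.exp (Complex.I * (l * u) * y) * G (σ + Complex.I * (l * y)) := by
  have e1 : ∫ t in Ioi (0:ℝ), (((S t - A) * Real.exp (-σ * t) * fejK (l * (u - t)) : ℝ) : ℂ) =
      ∫ t in Ioi (0:ℝ), ∫ y, (((S t - A) * Real.exp (-σ * t) : ℝ) : ℂ) * (fejW y : ℂ) * 
        Complex.exp (Complex.I * (l * (u - t) : ℝ) * y) := by
    apply integral_congr_ae
    have : ∀ᵐ t ∂(volume.restrict (Ioi (0:ℝ))), t ≠ u := by
      apply ae_restrict_of_ae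
      simp [ae_iff]
    filter_upwards [this] with t ht
    simp_rw [mul_assoc]
    rw [integral_const_mul]
    rw [show (fun y : ℝ => (fejW y : ℂ) * Complex.exp (Complex.I * (((l * (u - t) : ℝ) : ℂ) * y))) = (fun y : ℝ => (fejW y : ℂ) * Complex.exp (Complex.I * ((l * (u - t) : ℝ) : ℂ) * y)) by
      ext y; rw [mul_assoc]]
    rw [fejW_fourier _ (mul_ne_zero hl.ne' (sub_ne_zero.2 (Ne.symm ht)))]
    push_cast
    ring_nf
  rw [e1, integral_integral_swap]
  · apply integral_congr_ae
    filter_upwards with y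
    rw [hGL _ (by simpa using hσ), ← integral_const_mul]
    apply integral_congr_ae
    filter_upwards with t
    push_cast
    rw [show Complex.I * (l * (u - t)) * y = Complex.I * (l * u) * y + (-(Complex.I * (l * y)) * t) by ring,
      show -((σ:ℂ) + Complex.I * (l * y)) * t = -σ * t + (-(Complex.I * (l * y)) * t) by ring,
      Complex.exp_add, Complex.exp_add]
    ring
  · have hb : IntegrableOn (fun t => Real.exp (-σ * t)) (Ioi 0) := by
      simpa using integrableOn_exp_mul_Ioi (a := -σ) (by linarith) 0
    have h1 : Integrable (fun t => (((S t - A) * Real.exp (-σ * t) : ℝ) : ℂ)) (volume.restrict (Ioi (0:ℝ))) := by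
      apply Integrable.ofReal
      exact hb.bdd_mul (c := M) (by fun_prop) (by filter_upwards with t using hSM t)
    have h2 : Integrable (fun y => (fejW y : ℂ)) := fejW_integrable.ofReal
    have h3 := h1.mul_prod h2
    refine h3.mul_bdd (c := 1) ?_ ?_
    · apply Continuous.aestronglyMeasurable
      fun_prop
    · filter_upwards with z
      rw [show Complex.I * ((l * (u - z.1) : ℝ):ℂ) * z.2 = ((l * (u - z.1) * z.2 : ℝ) : ℂ) * Complex.I by push_cast; ring,
        Complex.norm_exp_ofReal_mul_I]

lemma fej_limit (S : ℝ → ℝ) (M A : ℝ) (hS : Measurable S) (hSM : ∀ t, |S t - A| ≤ M)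
    (G : ℂ → ℂ) (hG : ContinuousOn G {s | 0 ≤ s.re})
    (hGL : ∀ s : ℂ, 0 < s.re → G s = ∫ t in Ioi (0:ℝ), ((S t - A : ℝ) : ℂ) * Complex.exp (-s * t))
    (l u : ℝ) (hl : 0 < l) :
    ∫ t in Ioi (0:ℝ), (((S t - A) * fejK (l * (u - t)) : ℝ) : ℂ) =
      ∫ y, (fejW y : ℂ) * Complex.exp (Complex.I * (l * u) * y) * G (Complex.I * (l * y)) := by
  have hKi : Integrable (fun t => fejK (l * (u - t))) := by
    have := (fejK_integrable.comp_mul_left' hl.ne').comp_sub_left u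
    simpa using this
  have t1 : Tendsto (fun σ : ℝ => ∫ t in Ioi (0:ℝ), (((S t - A) * Real.exp (-σ * t) * fejK (l * (u - t)) : ℝ) : ℂ)) (𝓝[>] 0)
      (𝓝 (∫ t in Ioi (0:ℝ), (((S t - A) * fejK (l * (u - t)) : ℝ) : ℂ))) := by
    apply tendsto_integral_filter_of_dominated_convergence (fun t => M * fejK (l * (u - t)))
    · filter_upwards with σ
      have := fejK_measurable
      apply Measurable.aestronglyMeasurable
      fun_prop
    · filter_upwards [self_mem_nhdsWithin] with σ (hσ : 0 < σ)
      filter_upwards [ae_restrict_mem measurableSet_Ioi] with t (ht : 0 < t)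
      rw [Complex.norm_real, norm_mul, Real.norm_of_nonneg (fejK_nonneg _), norm_mul]
      gcongr
      · exact fejK_nonneg _
      · calc _ ≤ M * 1 := by
              gcongr
              · exact (abs_nonneg _).trans (hSM 0)
              · exact hSM t
              · rw [Real.norm_of_nonneg (Real.exp_nonneg _), Real.exp_le_one_iff]; nlinarith
          _ = M := mul_one _
    · exact (hKi.const_mul M).restrict
    · filter_upwards with t
      have : Continuous (fun σ : ℝ => (((S t - A) * Real.exp (-σ * t) * fejK (l * (u - t)) : ℝ) : ℂ)) := by fun_prop
      have := this.tendsto 0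
      simp only [neg_zero, zero_mul, Real.exp_zero, mul_one] at this
      exact this.mono_left nhdsWithin_le_nhds
  have t2 : Tendsto (fun σ : ℝ => ∫ y, (fejW y : ℂ) * Complex.exp (Complex.I * (l * u) * y) * G (σ + Complex.I * (l * y))) (𝓝[>] 0)
      (𝓝 (∫ y, (fejW y : ℂ) * Complex.exp (Complex.I * (l * u) * y) * G (Complex.I * (l * y)))) := by
    -- bound on compact
    have hcomp : IsCompact ((fun q : ℝ × ℝ => (q.1 : ℂ) + Complex.I * (l * q.2)) '' (Icc 0 1 ×ˢ Icc (-1) 1)) := 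
      (isCompact_Icc.prod isCompact_Icc).image (by fun_prop)
    have hsub : ((fun q : ℝ × ℝ => (q.1 : ℂ) + Complex.I * (l * q.2)) '' (Icc 0 1 ×ˢ Icc (-1) 1)) ⊆ {s : ℂ | 0 ≤ s.re} := by
      rintro _ ⟨q, hq, rfl⟩
      simpa using hq.1.1
    obtain ⟨C, hC⟩ := hcomp.exists_bound_of_continuousOn (hG.mono hsub)
    have hW0 : ∀ y, y ∉ Icc (-1:ℝ) 1 → fejW y = 0 := by
      intro y hy
      unfold fejW
      apply max_eq_left
      by_contra h
      push Not at h
      exact hy (abs_le.1 (by linarith))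
    apply tendsto_integral_filter_of_dominated_convergence (fun y => fejW y * C)
    · filter_upwards [self_mem_nhdsWithin] with σ (hσ : 0 < σ)
      apply Continuous.aestronglyMeasurable
      have := fejW_continuous
      have h2 : Continuous (fun y : ℝ => G (σ + Complex.I * (l * y))) := by
        apply hG.comp_continuous (by fun_prop)
        intro y; simpa using hσ.le
      exact Continuous.mul (by fun_prop) h2
    · have : Ioo (0:ℝ) 1 ∈ 𝓝[>] (0:ℝ) := Ioo_mem_nhdsGT one_pos
      filter_upwards [this] with σ hσ
      filter_upwards with y
      by_cases hy : y ∈ Icc (-1:ℝ) 1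
      · rw [norm_mul, norm_mul, Complex.norm_real, Real.norm_of_nonneg (fejW_nonneg _),
          show Complex.I * (l * u) * y = ((l * u * y : ℝ) : ℂ) * Complex.I by push_cast; ring,
          Complex.norm_exp_ofReal_mul_I, mul_one]
        gcongr
        · exact fejW_nonneg _
        · exact hC _ ⟨(σ, y), ⟨⟨hσ.1.le, hσ.2.le⟩, hy⟩, rfl⟩
      · simp [hW0 y hy]
    · exact fejW_integrable.mul_const C
    · filter_upwards with y
      apply Tendsto.const_mul
      have h2 : ContinuousWithinAt (fun σ : ℝ => G (σ + Complex.I * (l * y))) (Ici 0) 0 := by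
        apply ContinuousWithinAt.comp (t := {s : ℂ | 0 ≤ s.re})
        · apply hG; simp
        · fun_prop
        · intro σ hσ; simpa using hσ
      have h3 := h2.mono Ioi_subset_Ici_self
      simpa [ContinuousWithinAt] using h3
  refine tendsto_nhds_unique t1 (t2.congr' ?_)
  filter_upwards [self_mem_nhdsWithin] with σ (hσ : 0 < σ)
  exact (fej_fubini S M A hS hSM G hGL l u σ hl hσ).symm

lemma fej_tendsto_zero (S : ℝ → ℝ) (M A : ℝ) (hS : Measurable S) (hSM : ∀ t, |S t - A| ≤ M)
    (G : ℂ → ℂ) (hG : ContinuousOn G {s | 0 ≤ s.re})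
    (hGL : ∀ s : ℂ, 0 < s.re → G s = ∫ t in Ioi (0:ℝ), ((S t - A : ℝ) : ℂ) * Complex.exp (-s * t))
    (l : ℝ) (hl : 0 < l) :
    Tendsto (fun u : ℝ => ∫ t in Ioi (0:ℝ), (S t - A) * fejK (l * (u - t))) atTop (𝓝 0) := by
  have h1 := Real.tendsto_integral_exp_smul_cocompact (fun y : ℝ => (fejW y : ℂ) * G (Complex.I * (l * y)))
  have h2 : Tendsto (fun u : ℝ => -(l / (2 * Real.pi)) * u) atTop (cocompact ℝ) := by
    have : Tendsto (fun u : ℝ => -(l / (2 * Real.pi)) * u) atTop atBot := 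
      tendsto_id.const_mul_atTop_of_neg (by have := Real.pi_pos; have : 0 < l / (2 * Real.pi) := by positivity
                                            linarith)
    exact this.mono_right atBot_le_cocompact
  have h3 := h1.comp h2
  have h4 : Tendsto (fun u : ℝ => ((∫ t in Ioi (0:ℝ), (S t - A) * fejK (l * (u - t)) : ℝ) : ℂ)) atTop (𝓝 0) := by
    refine h3.congr ?_
    intro u
    rw [← integral_complex_ofReal, fej_limit S M A hS hSM G hG hGL l u hl]
    apply integral_congr_ae
    filter_upwards with y
    simp only [Circle.smul_def, Real.fourierChar_apply, smul_eq_mul]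
    have : Real.pi ≠ 0 := Real.pi_ne_zero
    rw [show (2 * Real.pi * -(y * (-(l / (2 * Real.pi)) * u)) : ℝ) = l * u * y by field_simp]
    push_cast
    rw [show (l:ℂ) * u * y * Complex.I = Complex.I * (l * u) * y by ring]
    ring
  have h5 := (Complex.continuous_re.tendsto _).comp h4
  simpa [Function.comp_def] using h5

theorem wiener_core (S : ℝ → ℝ) (M A : ℝ) (hA : 0 ≤ A) (hS : Measurable S) (hS0 : ∀ t, 0 ≤ S t) (hSM : ∀ t, S t ≤ M)
    (hSneg : ∀ t ≤ 0, S t = 0) (hmono : ∀ t t', t ≤ t' → S t * Real.exp t ≤ S t' * Real.exp t')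
    (G : ℂ → ℂ) (hG : ContinuousOn G {s | 0 ≤ s.re})
    (hGL : ∀ s : ℂ, 0 < s.re → G s = ∫ t in Ioi (0:ℝ), ((S t - A : ℝ) : ℂ) * Complex.exp (-s * t)) :
    Tendsto S atTop (𝓝 A) := by
  set c := ∫ u, fejK u with hc
  have hcpos : 0 < c := fejK_integral_pos
  have hM0 : 0 ≤ M := (hS0 0).trans (hSM 0)
  have hSM' : ∀ t, |S t - A| ≤ M + A := fun t => by
    rw [abs_le]; constructor <;> linarith [hS0 t, hSM t]
  -- integrability
  have hint : ∀ l u : ℝ, Integrable (fun v => fejK v * S (u - v / l)) := by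
    intro l u
    refine fejK_integrable.mul_bdd (c := M) (hS.comp (by fun_prop)).aestronglyMeasurable ?_
    filter_upwards with v
    rw [Real.norm_of_nonneg (hS0 _)]; exact hSM _
  have J : ∀ l : ℝ, 0 < l → Tendsto (fun u => ∫ v, fejK v * S (u - v / l)) atTop (𝓝 (A * c)) := by
    intro l hl
    have h1 := (fej_tendsto_zero S (M + A) A hS hSM' G hG hGL l hl).const_mul l
    have hKi : ∀ u, Integrable (fun t => fejK (l * (u - t))) := by
      intro u
      have := (fejK_integrable.comp_mul_left' hl.ne').comp_sub_left u
      simpa using this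
    -- change of variables
    have cv : ∀ (T : ℝ → ℝ) (u : ℝ), l * ∫ t, T t * fejK (l * (u - t)) = ∫ v, fejK v * T (u - v / l) := by
      intro T u
      have a1 : ∫ t, T t * fejK (l * (u - t)) = ∫ t, T (u - t) * fejK (l * t) := by
        rw [← integral_sub_left_eq_self (fun t => T (u - t) * fejK (l * t)) volume u]
        simp
      have a2 := Measure.integral_comp_mul_left (fun v => fejK v * T (u - v / l)) l
      rw [a1]
      have a3 : ∀ t, T (u - t) * fejK (l * t) = fejK (l * t) * T (u - l * t / l) := by
        intro t; rw [mul_div_cancel_left₀ _ hl.ne', mul_comm]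
      simp_rw [a3]
      rw [a2, abs_of_pos (inv_pos.2 hl), smul_eq_mul, mul_inv_cancel_left₀ hl.ne']
    have e1 : ∀ u, l * ∫ t in Ioi (0:ℝ), (S t - A) * fejK (l * (u - t)) = 
        (∫ v, fejK v * S (u - v / l)) - A * ∫ v in Iio (l * u), fejK v := by
      intro u
      simp_rw [sub_mul]
      rw [integral_sub, mul_sub]
      · congr 1
        · rw [← cv]
          congr 1
          rw [← integral_indicator measurableSet_Ioi]
          congr 1
          ext t
          by_cases ht : t ∈ Ioi (0:ℝ)
          · rw [indicator_of_mem ht]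
          · rw [indicator_of_notMem ht, hSneg t (not_lt.1 ht), zero_mul]
        · rw [integral_const_mul]
          have := cv (indicator (Ioi 0) 1) u
          rw [mul_left_comm, ← integral_indicator measurableSet_Ioi, ← integral_indicator measurableSet_Iio]
          congr 1
          convert! this using 2
          · congr 1
            ext t; by_cases ht : t ∈ Ioi (0:ℝ)
            · rw [indicator_of_mem ht, indicator_of_mem ht]; simp
            · rw [indicator_of_notMem ht, indicator_of_notMem ht]; simp
          · ext v
            by_cases hv : v ∈ Iio (l * u)
            · have : u - v / l ∈ Ioi (0:ℝ) := by
                have : v / l < u := by rw [div_lt_iff₀ hl, mul_comm]; exact hv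
                simpa using this
              rw [indicator_of_mem this, indicator_of_mem hv]; simp
            · have : u - v / l ∉ Ioi (0:ℝ) := by
                have : ¬ v / l < u := by rw [div_lt_iff₀ hl, mul_comm]; exact hv
                simpa using this
              rw [indicator_of_notMem this, indicator_of_notMem hv]; simp
      · apply Integrable.restrict
        refine (hKi u).bdd_mul (c := M) (by fun_prop) ?_
        filter_upwards with v
        rw [Real.norm_of_nonneg (hS0 _)]; exact hSM _
      · exact ((hKi u).const_mul A).restrict
    have h2 : Tendsto (fun u : ℝ => ∫ v in Iio (l * u), fejK v) atTop (𝓝 c) := by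
      have hu : Tendsto (fun u : ℝ => l * u) atTop atTop := tendsto_id.const_mul_atTop hl
      have : AECover volume atTop (fun x : ℝ => Iio x) := aecover_Iio tendsto_id
      exact (this.integral_tendsto_of_countably_generated fejK_integrable).comp hu
    have h3 := h1.add (h2.const_mul A)
    simp only [mul_zero, zero_add] at h3
    refine h3.congr ?_
    intro u
    rw [e1]; ring
  have hcV : Tendsto (fun V : ℝ => ∫ v in Icc (-V) V, fejK v) atTop (𝓝 c) := by
    have : AECover volume atTop (fun x : ℝ => Icc (-x) x) := aecover_Icc tendsto_neg_atTop_atBot tendsto_id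
    exact this.integral_tendsto_of_countably_generated fejK_integrable
  have hδ : Tendsto (fun V : ℝ => Real.exp (2 / V)) atTop (𝓝 1) := by
    have : Tendsto (fun V : ℝ => 2 / V) atTop (𝓝 0) := tendsto_const_nhds.div_atTop tendsto_id
    simpa [Function.comp_def] using (Real.continuous_exp.tendsto 0).comp this
  have up : ∀ V u : ℝ, 0 < V → S (u - 1 / V) * Real.exp (-(2 / V)) * (∫ v in Icc (-V) V, fejK v) ≤ 
      ∫ v, fejK v * S (u - v / V ^ 2) := by
    intro V u hV
    rw [← integral_const_mul]
    refine le_trans ?_ (setIntegral_le_integral (s := Icc (-V) V) (hint _ _) ?_)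
    · refine setIntegral_mono_on (fejK_integrable.const_mul _).integrableOn (hint _ _).integrableOn measurableSet_Icc ?_
      intro v hv
      rw [mul_comm (fejK v)]
      apply mul_le_mul_of_nonneg_right _ (fejK_nonneg v)
      have hv' : -(1 / V) ≤ v / V ^ 2 ∧ v / V ^ 2 ≤ 1 / V := by
        have : 1 / V = V / V ^ 2 := by field_simp
        rw [this, ← neg_div]
        constructor
        · gcongr; exact hv.1
        · gcongr; exact hv.2
      have := hmono (u - 1 / V) (u - v / V ^ 2) (by linarith [hv'.2])
      have h4 : S (u - 1 / V) * Real.exp (-(2 / V)) ≤ S (u - 1 / V) * Real.exp (v / V^2 - 1 / V) := by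
        apply mul_le_mul_of_nonneg_left _ (hS0 _)
        apply Real.exp_le_exp.2
        have : 2 / V = 1 / V + 1 / V := by ring
        linarith [hv'.1]
      refine h4.trans ?_
      rw [show v / V^2 - 1 / V = (u - 1 / V) - (u - v / V ^ 2) by ring, Real.exp_sub, ← mul_div_assoc, div_le_iff₀ (Real.exp_pos _)]
      exact this
    · filter_upwards with v
      exact mul_nonneg (fejK_nonneg v) (hS0 _)
  have lo : ∀ V u : ℝ, 0 < V → (∫ v, fejK v * S (u - v / V ^ 2)) ≤ S (u + 1 / V) * Real.exp (2 / V) * (∫ v in Icc (-V) V, fejK v)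
      + M * (c - ∫ v in Icc (-V) V, fejK v) := by
    intro V u hV
    rw [hc, ← integral_add_compl (measurableSet_Icc (a := -V) (b := V)) fejK_integrable, add_sub_cancel_left,
      ← integral_add_compl (measurableSet_Icc (a := -V) (b := V)) (hint _ _), ← integral_const_mul, ← integral_const_mul]
    apply add_le_add
    · refine setIntegral_mono_on (hint _ _).integrableOn (fejK_integrable.const_mul _).integrableOn measurableSet_Icc ?_
      intro v hv
      rw [mul_comm (fejK v)]
      apply mul_le_mul_of_nonneg_right _ (fejK_nonneg v)
      have hv' : -(1 / V) ≤ v / V ^ 2 ∧ v / V ^ 2 ≤ 1 / V := by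
        have : 1 / V = V / V ^ 2 := by field_simp
        rw [this, ← neg_div]
        constructor
        · gcongr; exact hv.1
        · gcongr; exact hv.2
      have := hmono (u - v / V ^ 2) (u + 1 / V) (by linarith [hv'.1])
      have h4 : S (u + 1 / V) * Real.exp (v / V^2 + 1 / V) ≤ S (u + 1 / V) * Real.exp (2 / V) := by
        apply mul_le_mul_of_nonneg_left _ (hS0 _)
        apply Real.exp_le_exp.2
        have : 2 / V = 1 / V + 1 / V := by ring
        linarith [hv'.2]
      refine le_trans ?_ h4
      rw [show v / V^2 + 1 / V = (u + 1 / V) - (u - v / V ^ 2) by ring, Real.exp_sub, ← mul_div_assoc, le_div_iff₀ (Real.exp_pos _)]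
      exact this
    · refine setIntegral_mono_on (hint _ _).integrableOn (fejK_integrable.const_mul _).integrableOn measurableSet_Icc.compl ?_
      intro v hv
      rw [mul_comm (fejK v)]
      exact mul_le_mul_of_nonneg_right (hSM _) (fejK_nonneg v)
  rw [tendsto_order]
  constructor
  · intro a ha
    have lim : Tendsto (fun V : ℝ => a * Real.exp (2 / V) * (∫ v in Icc (-V) V, fejK v)
      + M * (c - ∫ v in Icc (-V) V, fejK v)) atTop (𝓝 (a * 1 * c + M * (c - c))) := 
      ((hδ.const_mul a).mul hcV).add ((hcV.const_sub c).const_mul M)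
    have : a * 1 * c + M * (c - c) < A * c := by nlinarith
    obtain ⟨V, hV1, hV0⟩ := ((lim.eventually (gt_mem_nhds this)).and (eventually_gt_atTop 0)).exists
    have ev := (J (V ^ 2) (by positivity)).eventually (lt_mem_nhds hV1)
    have sh : Tendsto (fun u : ℝ => u - 1 / V) atTop atTop := tendsto_atTop_add_const_right _ _ tendsto_id
    filter_upwards [sh.eventually ev] with u hu
    have h5 := hu.trans_le (lo V (u - 1 / V) hV0)
    rw [sub_add_cancel] at h5
    have h6 : 0 ≤ ∫ v in Icc (-V) V, fejK v := integral_nonneg fejK_nonneg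
    by_contra hcon
    push Not at hcon
    have := mul_le_mul_of_nonneg_right (mul_le_mul_of_nonneg_right hcon (Real.exp_nonneg (2 / V))) h6
    linarith
  · intro a ha
    have lim : Tendsto (fun V : ℝ => a * (Real.exp (2 / V))⁻¹ * (∫ v in Icc (-V) V, fejK v)) atTop (𝓝 (a * 1⁻¹ * c)) := 
      (((hδ.inv₀ one_ne_zero).const_mul a).mul hcV)
    have : A * c < a * 1⁻¹ * c := by rw [inv_one, mul_one]; nlinarith
    obtain ⟨V, hV1, hV0⟩ := ((lim.eventually (lt_mem_nhds this)).and (eventually_gt_atTop 0)).exists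
    have ev := (J (V ^ 2) (by positivity)).eventually (gt_mem_nhds hV1)
    have sh : Tendsto (fun u : ℝ => u + 1 / V) atTop atTop := tendsto_atTop_add_const_right _ _ tendsto_id
    filter_upwards [sh.eventually ev] with u hu
    have h5 := (up V (u + 1 / V) hV0).trans_lt hu
    rw [add_sub_cancel_right, Real.exp_neg] at h5
    have h6 : 0 ≤ ∫ v in Icc (-V) V, fejK v := integral_nonneg fejK_nonneg
    by_contra hcon
    push Not at hcon
    have := mul_le_mul_of_nonneg_right (mul_le_mul_of_nonneg_right hcon (inv_nonneg.2 (Real.exp_nonneg (2 / V)))) h6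
    linarith

end partB

section partC
open Filter Asymptotics MeasureTheory Set Topology
open ArithmeticFunction.vonMangoldt (residueClass residueClass_nonneg residueClass_le LFunctionResidueClassAux continuousOn_LFunctionResidueClassAux eqOn_LFunctionResidueClassAux)

noncomputable def psiAP {q : ℕ} (a : ZMod q) (x : ℝ) : ℝ := ∑ n ∈ Finset.Icc 1 ⌊x⌋₊, residueClass a n

lemma psiAP_nonneg {q : ℕ} (a : ZMod q) (x : ℝ) : 0 ≤ psiAP a x :=
  Finset.sum_nonneg fun n _ => residueClass_nonneg a n

lemma psiAP_mono {q : ℕ} (a : ZMod q) : Monotone (psiAP a) := by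
  intro x y hxy
  unfold psiAP
  apply Finset.sum_le_sum_of_subset_of_nonneg
  · exact Finset.Icc_subset_Icc_right (Nat.floor_mono hxy)
  · intro n _ _; exact residueClass_nonneg a n

lemma psiAP_le_psi {q : ℕ} (a : ZMod q) (x : ℝ) : psiAP a x ≤ Chebyshev.psi x := by
  unfold psiAP Chebyshev.psi
  exact Finset.sum_le_sum fun n _ => residueClass_le a n

theorem psiAP_tendsto {q : ℕ} [NeZero q] (a : ZMod q) (ha : IsUnit a) :
    Tendsto (fun x : ℝ => psiAP a x / x) atTop (𝓝 ((q.totient : ℝ)⁻¹)) := by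
  set A : ℝ := (q.totient : ℝ)⁻¹ with hA
  set S : ℝ → ℝ := fun t => psiAP a (Real.exp t) * Real.exp (-t) with hSdef
  have hA0 : 0 ≤ A := by positivity
  have hmeas : Measurable S := by
    apply Measurable.mul
    · exact (psiAP_mono a).measurable.comp Real.measurable_exp
    · fun_prop
  have hS0 : ∀ t, 0 ≤ S t := fun t => mul_nonneg (psiAP_nonneg _ _) (Real.exp_nonneg _)
  set M : ℝ := Real.log 4 + 4 with hM
  have hSM : ∀ t, S t ≤ M := by
    intro t
    simp only [hSdef]
    rw [Real.exp_neg, ← div_eq_mul_inv, div_le_iff₀ (Real.exp_pos _)]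
    exact (psiAP_le_psi a _).trans (Chebyshev.psi_le_const_mul_self (Real.exp_nonneg _))
  have hSneg : ∀ t ≤ 0, S t = 0 := by
    intro t ht
    have h1 := psiAP_le_psi a (Real.exp t)
    rw [Chebyshev.psi_eq_zero_of_le_one (Real.exp_le_one_iff.2 ht)] at h1
    have := le_antisymm h1 (psiAP_nonneg a _)
    simp [hSdef, this]
  have hexp : ∀ t, S t * Real.exp t = psiAP a (Real.exp t) := by
    intro t; simp only [hSdef]; rw [mul_assoc, ← Real.exp_add]; simp
  have hmono : ∀ t t', t ≤ t' → S t * Real.exp t ≤ S t' * Real.exp t' := by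
    intro t t' h
    rw [hexp, hexp]
    exact psiAP_mono a (Real.exp_le_exp.2 h)
  set G : ℂ → ℂ := fun s => (LFunctionResidueClassAux a (s + 1) - A) / (s + 1) with hGdef
  have hG : ContinuousOn G {s | 0 ≤ s.re} := by
    apply ContinuousOn.div
    · apply ContinuousOn.sub _ continuousOn_const
      apply (continuousOn_LFunctionResidueClassAux a).comp (by fun_prop)
      intro s hs
      have : 0 ≤ s.re := hs
      simpa using this
    · fun_prop
    · intro s hs h
      have : 0 ≤ s.re := hs
      have h2 := congrArg Complex.re h
      simp at h2
      linarith
  have hGL : ∀ s : ℂ, 0 < s.re → G s = ∫ t in Ioi (0:ℝ), ((S t - A : ℝ) : ℂ) * Complex.exp (-s * t) := by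
    intro s hs
    have hO : (fun n : ℕ ↦ ∑ k ∈ Finset.Icc 1 n, residueClass a k) =O[atTop] fun n ↦ (n : ℝ) ^ (1:ℝ) := by
      apply IsBigO.of_bound M
      filter_upwards with n
      have h1 := psiAP_nonneg a n
      have h2 := (psiAP_le_psi a n).trans (Chebyshev.psi_le_const_mul_self (Nat.cast_nonneg n))
      unfold psiAP at h1 h2
      rw [Nat.floor_natCast] at h1 h2
      rw [Real.norm_of_nonneg h1, Real.rpow_one, Real.norm_of_nonneg (Nat.cast_nonneg n)]
      exact h2
    have hL := LSeries_eq_mul_integral_of_nonneg (residueClass a) (r := 1) zero_le_one (s := s + 1) (by simpa using hs) hO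
      (residueClass_nonneg a)
    have himg : Real.exp '' (Ioi 0) = Ioi 1 := by
      ext x
      constructor
      · rintro ⟨t, ht, rfl⟩
        exact Real.one_lt_exp_iff.2 ht
      · intro hx
        exact ⟨Real.log x, Real.log_pos hx, Real.exp_log (lt_trans one_pos hx)⟩
    have hcv := integral_image_eq_integral_abs_deriv_smul (s := Ioi (0:ℝ)) (f := Real.exp) (f' := Real.exp) measurableSet_Ioi
      (fun t _ => (Real.hasDerivAt_exp t).hasDerivWithinAt) Real.exp_injective.injOn
      (fun t : ℝ => (∑ k ∈ Finset.Icc 1 ⌊t⌋₊, (residueClass a k : ℂ)) * (t:ℂ) ^ (-((s + 1) + 1)))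
    rw [himg] at hcv
    rw [hcv] at hL
    have hi : ∫ t in Ioi (0:ℝ), |Real.exp t| • ((∑ k ∈ Finset.Icc 1 ⌊Real.exp t⌋₊, (residueClass a k : ℂ)) * (Real.exp t:ℂ) ^ (-((s + 1) + 1)))
       = ∫ t in Ioi (0:ℝ), (S t : ℂ) * Complex.exp (-s * t) := by
      apply integral_congr_ae
      filter_upwards with t
      have e1 : (Real.exp t : ℂ) ^ (-((s + 1) + 1)) = Complex.exp (-s * t) * Complex.exp (-t) * Complex.exp (-t) := by
        rw [Complex.cpow_def_of_ne_zero (by exact_mod_cast (Real.exp_pos t).ne'), ← Complex.ofReal_log (Real.exp_nonneg t), Real.log_exp,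
          ← Complex.exp_add, ← Complex.exp_add]
        congr 1; ring
      rw [e1, abs_of_pos (Real.exp_pos t), Complex.real_smul]
      simp only [hSdef, psiAP]
      push_cast
      have : Complex.exp t * Complex.exp (-t) = 1 := by rw [← Complex.exp_add]; simp
      linear_combination (∑ k ∈ Finset.Icc 1 ⌊Real.exp t⌋₊, (residueClass a k : ℂ)) * Complex.exp (-s * t) * Complex.exp (-t) * this
    rw [hi] at hL
    have hAux := eqOn_LFunctionResidueClassAux ha (show s + 1 ∈ {s : ℂ | 1 < s.re} by simpa using hs)
    simp only at hAux
    have hs0 : s ≠ 0 := by rintro rfl; simp at hs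
    have hs1 : s + 1 ≠ 0 := by
      intro h
      have h2 := congrArg Complex.re h
      simp at h2
      linarith
    have hexpint : IntegrableOn (fun t : ℝ => Complex.exp (-s * t)) (Ioi 0) := 
      integrableOn_exp_mul_complex_Ioi (a := -s) (by simpa using hs) 0
    have hAint : ∫ t in Ioi (0:ℝ), Complex.exp (-s * t) = 1 / s := by
      rw [integral_exp_mul_complex_Ioi (a := -s) (by simpa using hs) 0]
      simp
    simp only [Complex.ofReal_sub, sub_mul]
    rw [integral_sub, integral_const_mul, hAint]
    · simp only [hGdef]
      rw [hAux, hL]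
      have : ((q.totient : ℂ)⁻¹) = (A : ℂ) := by simp [hA]
      rw [this, add_sub_cancel_right]
      field_simp
      ring
    · refine hexpint.bdd_mul (c := M) (by fun_prop) ?_
      filter_upwards with t
      rw [Complex.norm_real, Real.norm_of_nonneg (hS0 t)]
      exact hSM t
    · exact hexpint.const_mul _
  have key := wiener_core S M A hA0 hmeas hS0 hSM hSneg hmono G hG hGL
  refine (key.comp Real.tendsto_log_atTop).congr' ?_
  filter_upwards [eventually_gt_atTop 0] with x hx
  simp only [Function.comp, hSdef]
  rw [Real.exp_neg, Real.exp_log hx, div_eq_mul_inv]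

noncomputable def thetaAP {q : ℕ} (a : ZMod q) (x : ℝ) : ℝ :=
  ∑ p ∈ Finset.Icc 1 ⌊x⌋₊, if p.Prime ∧ (p : ZMod q) = a then Real.log p else 0

theorem thetaAP_tendsto {q : ℕ} [NeZero q] (a : ZMod q) (ha : IsUnit a) :
    Tendsto (fun x : ℝ => thetaAP a x / x) atTop (𝓝 ((q.totient : ℝ)⁻¹)) := by
  obtain ⟨C, hC⟩ := Chebyshev.psi_sub_theta_le_mul_sqrt
  have h0 : ∀ x : ℝ, psiAP a x - thetaAP a x ≤ Chebyshev.psi x - Chebyshev.theta x ∧ 0 ≤ psiAP a x - thetaAP a x := by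
    intro x
    have e : psiAP a x - thetaAP a x = ∑ n ∈ Finset.Icc 1 ⌊x⌋₊, if n.Prime then 0 else residueClass a n := by
      unfold psiAP thetaAP
      rw [← Finset.sum_sub_distrib]
      refine Finset.sum_congr rfl fun n _ => ?_
      by_cases hn : n.Prime
      · by_cases hna : (n : ZMod q) = a
        · simp [hn, hna, residueClass, ArithmeticFunction.vonMangoldt_apply_prime]
        · simp [hn, hna, residueClass]
      · simp [hn]
    constructor
    · rw [Chebyshev.psi_sub_theta_eq_sum_not_prime, e, Finset.sum_filter]
      refine Finset.sum_le_sum fun n _ => ?_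
      by_cases hn : n.Prime
      · simp [hn]
      · simp only [hn, if_false, not_false_eq_true, if_true]; exact residueClass_le a n
    · rw [e]
      refine Finset.sum_nonneg fun n _ => ?_
      split_ifs
      · exact le_rfl
      · exact residueClass_nonneg a n
  have h1 : Tendsto (fun x : ℝ => (psiAP a x - thetaAP a x) / x) atTop (𝓝 0) := by
    have hb : Tendsto (fun x : ℝ => C * (x ^ (-(1/2 : ℝ)))) atTop (𝓝 0) := by
      simpa using (tendsto_rpow_neg_atTop (y := (1/2:ℝ)) (by norm_num)).const_mul C
    refine tendsto_of_tendsto_of_tendsto_of_le_of_le' tendsto_const_nhds hb ?_ ?_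
    · filter_upwards [eventually_gt_atTop 0] with x hx using div_nonneg (h0 x).2 hx.le
    · filter_upwards [eventually_gt_atTop 0] with x hx
      rw [div_le_iff₀ hx]
      refine ((h0 x).1.trans (hC x)).trans (le_of_eq ?_)
      rw [mul_assoc]
      nth_rw 3 [← Real.rpow_one x]
      rw [← Real.rpow_add hx, Real.sqrt_eq_rpow]
      norm_num
  have := (psiAP_tendsto a ha).sub h1
  rw [sub_zero] at this
  refine this.congr fun x => ?_
  ring

end partC

section partD
open Filter Asymptotics MeasureTheory Set Topology

def goodN (n : ℕ) : Prop := Squarefree n ∧ ∀ p : ℕ, p.Prime → p ∣ n → jacobiSym 2 p = 1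

open Classical in
noncomputable def fI (n : ℕ) : ℝ := if goodN n then 1 else 0

lemma fI_nonneg (n : ℕ) : 0 ≤ fI n := by unfold fI; split_ifs <;> norm_num
lemma fI_le_one (n : ℕ) : fI n ≤ 1 := by unfold fI; split_ifs <;> norm_num

lemma fI_mul {m n : ℕ} (h : m.Coprime n) : fI (m * n) = fI m * fI n := by
  have : goodN (m * n) ↔ goodN m ∧ goodN n := by
    unfold goodN
    rw [Nat.squarefree_mul h]
    constructor
    · rintro ⟨⟨h1, h2⟩, h3⟩
      exact ⟨⟨h1, fun p hp hd => h3 p hp (hd.mul_right _)⟩, ⟨h2, fun p hp hd => h3 p hp (hd.mul_left _)⟩⟩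
    · rintro ⟨⟨h1, h2⟩, ⟨h3, h4⟩⟩
      refine ⟨⟨h1, h3⟩, fun p hp hd => ?_⟩
      rcases hp.dvd_mul.1 hd with h | h
      · exact h2 p hp h
      · exact h4 p hp h
  unfold fI
  by_cases h1 : goodN m <;> by_cases h2 : goodN n <;> simp [this, h1, h2]

lemma fI_eq_zero {n : ℕ} (h : ¬ Squarefree n) : fI n = 0 := by
  unfold fI
  rw [if_neg]
  exact fun h' => h h'.1

lemma sum_log_eq (n : ℕ) (hn : Squarefree n) : Real.log n = ∑ p ∈ n.primeFactors, Real.log p := by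
  conv_lhs => rw [← Nat.prod_primeFactors_of_squarefree hn]
  push_cast
  rw [Real.log_prod]
  intro p hp
  exact_mod_cast (Nat.prime_of_mem_primeFactors hp).ne_zero

lemma sum_multiples (h : ℕ → ℝ) (N p : ℕ) (hp : 0 < p) :
    ∑ n ∈ Finset.Icc 1 N with p ∣ n, h n = ∑ m ∈ Finset.Icc 1 (N / p), h (p * m) := by
  symm
  refine Finset.sum_bij (fun m _ => p * m) ?_ ?_ ?_ ?_
  · intro m hm
    simp only [Finset.mem_Icc, Finset.mem_filter] at hm ⊢
    refine ⟨⟨Nat.mul_pos hp hm.1, ?_⟩, dvd_mul_right _ _⟩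
    rw [mul_comm]; exact (Nat.le_div_iff_mul_le hp).1 hm.2
  · intro a _ b _ hab
    exact Nat.eq_of_mul_eq_mul_left hp hab
  · intro n hn
    simp only [Finset.mem_Icc, Finset.mem_filter] at hn
    obtain ⟨⟨h1, h2⟩, m, rfl⟩ := hn
    refine ⟨m, ?_, rfl⟩
    simp only [Finset.mem_Icc]
    exact ⟨Nat.pos_of_mul_pos_left h1, (Nat.le_div_iff_mul_le hp).2 (by rwa [mul_comm])⟩
  · intro m _; rfl

lemma sum_swap (g : ℕ → ℕ → ℝ) (N : ℕ) :
    ∑ p ∈ Finset.Icc 1 N, ∑ m ∈ Finset.Icc 1 (N / p), g p m = ∑ m ∈ Finset.Icc 1 N, ∑ p ∈ Finset.Icc 1 (N / m), g p m := by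
  apply Finset.sum_comm'
  intro p m
  simp only [Finset.mem_Icc]
  constructor
  · rintro ⟨⟨h1, h2⟩, h3, h4⟩
    have h5 := (Nat.le_div_iff_mul_le h1).1 h4
    exact ⟨⟨h1, (Nat.le_div_iff_mul_le h3).2 (by rwa [mul_comm])⟩, h3, by nlinarith⟩
  · rintro ⟨⟨h1, h2⟩, h3, h4⟩
    have h5 := (Nat.le_div_iff_mul_le h3).1 h2
    exact ⟨⟨h1, by nlinarith⟩, h3, (Nat.le_div_iff_mul_le h1).2 (by rwa [mul_comm])⟩

/-- weighted prime sum -/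
noncomputable def Th (χ : ℕ → ℝ) (n : ℕ) : ℝ := ∑ p ∈ Finset.Icc 1 n, if p.Prime then χ p * fI p * Real.log p else 0

lemma summable_log_div_sq : Summable (fun n : ℕ => Real.log n / (n:ℝ) ^ 2) := by
  have h : Summable (fun n : ℕ => 2 * (1 / (n:ℝ) ^ (3/2 : ℝ))) := (Real.summable_one_div_nat_rpow.2 (by norm_num)).mul_left 2
  refine Summable.of_nonneg_of_le (fun n => div_nonneg (Real.log_natCast_nonneg n) (by positivity)) (fun n => ?_) h
  rcases Nat.eq_zero_or_pos n with rfl | hn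
  · simp
  have hn' : (0:ℝ) < n := by exact_mod_cast hn
  have h1 := Real.log_le_rpow_div hn'.le (ε := 1/2) (by norm_num)
  rw [div_le_iff₀ (by positivity)]
  refine h1.trans (le_of_eq ?_)
  have : (n:ℝ)^2 = (n:ℝ)^(1/2:ℝ) * (n:ℝ)^(3/2:ℝ) := by
    rw [← Real.rpow_add hn']; norm_num
  rw [this]
  have : (0:ℝ) < (n:ℝ)^(3/2:ℝ) := by positivity
  field_simp

lemma step1 (χ : ℕ → ℝ) (hχ1 : ∀ n, |χ n| ≤ 1) (hχm : ∀ m n, χ (m * n) = χ m * χ n) (N : ℕ) :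
    |(∑ n ∈ Finset.Icc 1 N, fI n * χ n * Real.log n) - ∑ m ∈ Finset.Icc 1 N, fI m * χ m * Th χ (N / m)| 
      ≤ (∑' n : ℕ, Real.log n / (n:ℝ) ^ 2) * N := by
  have e1 : ∑ n ∈ Finset.Icc 1 N, fI n * χ n * Real.log n = 
      ∑ p ∈ Finset.Icc 1 N, ∑ m ∈ Finset.Icc 1 (N / p), if p.Prime then fI (p * m) * χ (p * m) * Real.log p else 0 := by
    have a1 : ∀ n ∈ Finset.Icc 1 N, fI n * χ n * Real.log n = 
        ∑ p ∈ Finset.Icc 1 N, if p ∣ n then (if p.Prime then fI n * χ n * Real.log p else 0) else 0 := by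
      intro n hn
      rw [Finset.mem_Icc] at hn
      by_cases hs : Squarefree n
      · rw [sum_log_eq n hs, Finset.mul_sum]
        simp_rw [← ite_and]
        rw [← Finset.sum_filter]
        apply Finset.sum_congr _ (fun _ _ => rfl)
        ext p
        simp only [Nat.mem_primeFactors, Finset.mem_filter, Finset.mem_Icc]
        constructor
        · rintro ⟨h1, h2, h3⟩
          exact ⟨⟨h1.one_le, (Nat.le_of_dvd (by omega) h2).trans hn.2⟩, h2, h1⟩
        · rintro ⟨_, h2, h1⟩
          exact ⟨h1, h2, by omega⟩
      · simp [fI_eq_zero hs]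
    rw [Finset.sum_congr rfl a1, Finset.sum_comm]
    apply Finset.sum_congr rfl
    intro p hp
    rw [Finset.mem_Icc] at hp
    rw [← Finset.sum_filter]
    exact sum_multiples (fun n => if p.Prime then fI n * χ n * Real.log p else 0) N p hp.1
  have e2 : ∑ m ∈ Finset.Icc 1 N, fI m * χ m * Th χ (N / m) = 
      ∑ p ∈ Finset.Icc 1 N, ∑ m ∈ Finset.Icc 1 (N / p), if p.Prime then fI m * χ m * (χ p * fI p * Real.log p) else 0 := by
    rw [sum_swap]
    apply Finset.sum_congr rfl
    intro m _
    unfold Th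
    rw [Finset.mul_sum]
    apply Finset.sum_congr rfl
    intro p _
    split_ifs <;> simp
  rw [e1, e2, ← Finset.sum_sub_distrib]
  refine (Finset.abs_sum_le_sum_abs _ _).trans ?_
  rw [← tsum_mul_right]
  refine le_trans (Finset.sum_le_sum (fun p hp => ?_)) 
    ((summable_log_div_sq.mul_right (N:ℝ)).sum_le_tsum (Finset.Icc 1 N) (fun n _ => by have := Real.log_natCast_nonneg n; positivity))
  rw [Finset.mem_Icc] at hp
  have hlog := Real.log_natCast_nonneg p
  by_cases hpp : p.Prime
  swap
  · simp only [hpp, if_false]; simp; positivity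
  simp only [hpp, if_true]
  rw [← Finset.sum_sub_distrib]
  refine (Finset.abs_sum_le_sum_abs _ _).trans ?_
  have b1 : ∀ m ∈ Finset.Icc 1 (N / p), |fI (p * m) * χ (p * m) * Real.log p - fI m * χ m * (χ p * fI p * Real.log p)| ≤ 
      if p ∣ m then Real.log p else 0 := by
    intro m _
    split_ifs with hd
    · have : ¬ Squarefree (p * m) := by
        obtain ⟨k, rfl⟩ := hd
        intro hsq
        have := hsq p (by rw [← mul_assoc]; exact dvd_mul_right _ _)
        exact hpp.one_lt.ne' (Nat.isUnit_iff.1 this)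
      rw [fI_eq_zero this]
      simp only [zero_mul, zero_sub, abs_neg, abs_mul, abs_of_nonneg (fI_nonneg _), abs_of_nonneg hlog]
      have h1 := fI_le_one m
      have h2 := fI_le_one p
      have h3 := hχ1 m
      have h4 := hχ1 p
      have h5 := fI_nonneg p
      calc fI m * |χ m| * (|χ p| * fI p * Real.log p) ≤ 1 * 1 * (1 * 1 * Real.log p) := by gcongr
        _ = _ := by ring
    · rw [fI_mul ((Nat.Prime.coprime_iff_not_dvd hpp).2 hd), hχm]
      apply le_of_eq
      rw [abs_eq_zero]; ring
  refine (Finset.sum_le_sum b1).trans ?_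
  rw [← Finset.sum_filter, Finset.sum_const, nsmul_eq_mul]
  have : (Finset.Icc 1 (N / p)).filter (fun m => p ∣ m) = (Finset.Ioc 0 (N / p)).filter (fun m => p ∣ m) := rfl
  rw [this, Nat.Ioc_filter_dvd_card_eq_div, Nat.div_div_eq_div_mul]
  have : ((N / (p * p) : ℕ) : ℝ) ≤ N / (p:ℝ)^2 := by
    refine Nat.cast_div_le.trans (le_of_eq ?_)
    push_cast; ring
  calc _ ≤ N / (p:ℝ)^2 * Real.log p := by gcongr
    _ = _ := by ring

lemma step3 (χ : ℕ → ℝ) (hχ1 : ∀ n, |χ n| ≤ 1) (N : ℕ) :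
    |(∑ n ∈ Finset.Icc 1 N, fI n * χ n) * Real.log N - ∑ n ∈ Finset.Icc 1 N, fI n * χ n * Real.log n| ≤ N := by
  rcases Nat.eq_zero_or_pos N with rfl | hN
  · simp
  have hN' : (0:ℝ) < N := by exact_mod_cast hN
  rw [Finset.sum_mul, ← Finset.sum_sub_distrib]
  refine (Finset.abs_sum_le_sum_abs _ _).trans ?_
  have b : ∀ n ∈ Finset.Icc 1 N, |fI n * χ n * Real.log N - fI n * χ n * Real.log n| ≤ Real.log N - Real.log n := by
    intro n hn
    rw [Finset.mem_Icc] at hn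
    have hl : Real.log n ≤ Real.log N := Real.log_le_log (by exact_mod_cast hn.1) (by exact_mod_cast hn.2)
    rw [← mul_sub, abs_mul, abs_mul, abs_of_nonneg (sub_nonneg.2 hl), abs_of_nonneg (fI_nonneg n)]
    calc _ ≤ 1 * 1 * (Real.log N - Real.log n) := by
          gcongr
          · exact fI_le_one n
          · exact hχ1 n
      _ = _ := by ring
  refine (Finset.sum_le_sum b).trans ?_
  rw [Finset.sum_sub_distrib, Finset.sum_const, Nat.card_Icc, nsmul_eq_mul, Nat.add_sub_cancel]
  have hf : ∑ n ∈ Finset.Icc 1 N, Real.log n = Real.log (N.factorial) := by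
    rw [← Finset.prod_Ico_id_eq_factorial N, show Finset.Ico 1 (N + 1) = Finset.Icc 1 N by ext; simp]
    push_cast
    rw [Real.log_prod]
    intro n hn
    rw [Finset.mem_Icc] at hn
    have : 0 < n := hn.1
    exact_mod_cast this.ne'
  rw [hf]
  have h1 := Real.pow_div_factorial_le_exp (N:ℝ) hN'.le N
  have h2 := Real.log_le_log (by positivity) h1
  rw [Real.log_exp, Real.log_div (by positivity) (by positivity), Real.log_pow] at h2
  exact h2

lemma Th_abs_le (χ : ℕ → ℝ) (hχ1 : ∀ n, |χ n| ≤ 1) (n : ℕ) : |Th χ n| ≤ Real.log 4 * n := by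
  have h := Chebyshev.theta_le_log4_mul_x (Nat.cast_nonneg n)
  refine le_trans ?_ h
  unfold Th Chebyshev.theta
  rw [Nat.floor_natCast, Finset.sum_filter]
  refine (Finset.abs_sum_le_sum_abs _ _).trans ?_
  refine Finset.sum_le_sum fun p _ => ?_
  split_ifs
  · have hlog := Real.log_natCast_nonneg p
    rw [abs_mul, abs_mul, abs_of_nonneg hlog, abs_of_nonneg (fI_nonneg p)]
    calc _ ≤ 1 * 1 * Real.log p := by
          gcongr
          · exact fI_nonneg p
          · exact hχ1 p
          · exact fI_le_one p
      _ = _ := by ring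
  · simp

theorem wirsing (χ : ℕ → ℝ) (hχ1 : ∀ n, |χ n| ≤ 1) (hχm : ∀ m n, χ (m * n) = χ m * χ n) (τ κ ℓ : ℝ)
    (hθ : Tendsto (fun x : ℝ => Th χ ⌊x⌋₊ / x) atTop (𝓝 τ))
    (hL : Tendsto (fun N : ℕ => (∑ n ∈ Finset.Icc 1 N, fI n / n) / √(Real.log N)) atTop (𝓝 ℓ))
    (hLw : Tendsto (fun N : ℕ => τ * (∑ n ∈ Finset.Icc 1 N, fI n * χ n / n) / √(Real.log N)) atTop (𝓝 κ)) :
    Tendsto (fun N : ℕ => (∑ n ∈ Finset.Icc 1 N, fI n * χ n) * √(Real.log N) / N) atTop (𝓝 κ) := by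
  have hlogT : Tendsto (fun N : ℕ => √(Real.log N)) atTop atTop :=
    Real.tendsto_sqrt_atTop.comp (Real.tendsto_log_atTop.comp tendsto_natCast_atTop_atTop)
  -- main inequality
  have main : ∀ ε > 0, ∃ C : ℝ, ∀ N : ℕ, |(∑ n ∈ Finset.Icc 1 N, fI n * χ n) * Real.log N - 
      τ * N * (∑ n ∈ Finset.Icc 1 N, fI n * χ n / n)| ≤ ε * N * (∑ n ∈ Finset.Icc 1 N, fI n / n) + C * N := by
    intro ε hε
    have hev : ∀ᶠ x : ℝ in atTop, |Th χ ⌊x⌋₊ / x - τ| < ε := by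
      have := hθ.eventually (Metric.ball_mem_nhds τ hε)
      simpa [Real.dist_eq] using this
    obtain ⟨y0, hy0⟩ := eventually_atTop.1 hev
    set Y := max y0 1 with hY
    have hTh : ∀ y : ℝ, 0 < y → |Th χ ⌊y⌋₊ - τ * y| ≤ ε * y + (Real.log 4 + |τ|) * Y := by
      intro y hy
      have hl4 : 0 ≤ Real.log 4 := Real.log_nonneg (by norm_num)
      have hYpos : 0 < Y := lt_of_lt_of_le one_pos (le_max_right _ _)
      rcases le_total Y y with h | h
      · have := hy0 y ((le_max_left _ _).trans h)
        have e : Th χ ⌊y⌋₊ - τ * y = (Th χ ⌊y⌋₊ / y - τ) * y := by field_simp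
        rw [e, abs_mul, abs_of_pos hy]
        have : |Th χ ⌊y⌋₊ / y - τ| * y ≤ ε * y := by gcongr
        have : 0 ≤ (Real.log 4 + |τ|) * Y := by positivity
        linarith
      · have h1 := Th_abs_le χ hχ1 ⌊y⌋₊
        have h2 := Nat.floor_le hy.le
        calc _ ≤ |Th χ ⌊y⌋₊| + |τ * y| := abs_sub _ _
          _ ≤ Real.log 4 * Y + |τ| * Y := by
            rw [abs_mul, abs_of_pos hy]
            have : Real.log 4 * ⌊y⌋₊ ≤ Real.log 4 * Y := by gcongr; linarith
            have : |τ| * y ≤ |τ| * Y := by gcongr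
            linarith
          _ ≤ _ := by have : 0 < ε * y := by positivity
                      linarith
    refine ⟨(∑' n : ℕ, Real.log n / (n:ℝ) ^ 2) + 1 + (Real.log 4 + |τ|) * Y, fun N => ?_⟩
    have s1 := step1 χ hχ1 hχm N
    have s3 := step3 χ hχ1 N
    have hl4 : 0 ≤ Real.log 4 := Real.log_nonneg (by norm_num)
    have hYpos : 0 < Y := lt_of_lt_of_le one_pos (le_max_right _ _)
    have s2 : |(∑ m ∈ Finset.Icc 1 N, fI m * χ m * Th χ (N / m)) - τ * N * (∑ n ∈ Finset.Icc 1 N, fI n * χ n / n)| ≤ 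
        ε * N * (∑ n ∈ Finset.Icc 1 N, fI n / n) + (Real.log 4 + |τ|) * Y * N := by
      rw [Finset.mul_sum, ← Finset.sum_sub_distrib]
      refine (Finset.abs_sum_le_sum_abs _ _).trans ?_
      have b : ∀ n ∈ Finset.Icc 1 N, |fI n * χ n * Th χ (N / n) - τ * N * (fI n * χ n / n)| ≤ 
          ε * N * (fI n / n) + (Real.log 4 + |τ|) * Y := by
        intro n hn
        rw [Finset.mem_Icc] at hn
        have hn0 : (0:ℝ) < n := by exact_mod_cast hn.1
        have hN0 : (0:ℝ) < N := by exact_mod_cast (hn.1.trans hn.2)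
        have h1 := hTh (N / n) (by positivity)
        rw [Nat.floor_div_natCast, Nat.floor_natCast] at h1
        rw [show fI n * χ n * Th χ (N / n) - τ * N * (fI n * χ n / n) = fI n * χ n * (Th χ (N / n) - τ * (N / n)) by ring,
          abs_mul, abs_mul, abs_of_nonneg (fI_nonneg n)]
        have hf0 := fI_nonneg n
        calc fI n * |χ n| * |Th χ (N / n) - τ * (N / n)| ≤ fI n * 1 * (ε * (N / n) + (Real.log 4 + |τ|) * Y) := by
              gcongr
              exact hχ1 n
          _ = ε * N * (fI n / n) + fI n * ((Real.log 4 + |τ|) * Y) := by ring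
          _ ≤ ε * N * (fI n / n) + 1 * ((Real.log 4 + |τ|) * Y) := by
              gcongr
              exact fI_le_one n
          _ = _ := by ring
      refine (Finset.sum_le_sum b).trans (le_of_eq ?_)
      rw [Finset.sum_add_distrib, ← Finset.mul_sum, Finset.sum_const, Nat.card_Icc, nsmul_eq_mul, Nat.add_sub_cancel]
      ring
    rw [abs_le] at *
    constructor <;> nlinarith
  -- conclusion
  have hdiff : Tendsto (fun N : ℕ => (∑ n ∈ Finset.Icc 1 N, fI n * χ n) * √(Real.log N) / N - 
      τ * (∑ n ∈ Finset.Icc 1 N, fI n * χ n / n) / √(Real.log N)) atTop (𝓝 0) := by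
    rw [Metric.tendsto_nhds]
    intro ε hε
    have hε' : 0 < ε / (2 * (|ℓ| + 1)) := by positivity
    obtain ⟨C, hC⟩ := main _ hε'
    have hlim : Tendsto (fun N : ℕ => ε / (2 * (|ℓ| + 1)) * ((∑ n ∈ Finset.Icc 1 N, fI n / n) / √(Real.log N)) + C / √(Real.log N)) atTop
        (𝓝 (ε / (2 * (|ℓ| + 1)) * ℓ + 0)) := (hL.const_mul _).add (tendsto_const_nhds.div_atTop hlogT)
    have hlt : ε / (2 * (|ℓ| + 1)) * ℓ + 0 < ε := by
      have : ε / (2 * (|ℓ| + 1)) * ℓ ≤ ε / (2 * (|ℓ| + 1)) * (|ℓ| + 1) := by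
        gcongr; linarith [le_abs_self ℓ]
      have e : ε / (2 * (|ℓ| + 1)) * (|ℓ| + 1) = ε / 2 := by field_simp
      linarith
    filter_upwards [hlim.eventually (gt_mem_nhds hlt), eventually_ge_atTop 2] with N h1 hN2
    rw [Real.dist_eq, sub_zero]
    refine lt_of_le_of_lt ?_ h1
    have hN0 : (0:ℝ) < N := by exact_mod_cast (by omega : 0 < N)
    have hlogpos : 0 < Real.log N := Real.log_pos (by exact_mod_cast (by omega : 1 < N))
    have hs : 0 < √(Real.log N) := Real.sqrt_pos.2 hlogpos
    have hss : √(Real.log N) * √(Real.log N) = Real.log N := Real.mul_self_sqrt hlogpos.le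
    have e : (∑ n ∈ Finset.Icc 1 N, fI n * χ n) * √(Real.log N) / N - 
      τ * (∑ n ∈ Finset.Icc 1 N, fI n * χ n / n) / √(Real.log N) = 
      ((∑ n ∈ Finset.Icc 1 N, fI n * χ n) * Real.log N - 
      τ * N * (∑ n ∈ Finset.Icc 1 N, fI n * χ n / n)) / (N * √(Real.log N)) := by
      field_simp
      rw [Real.sq_sqrt hlogpos.le]
    rw [e, abs_div, abs_of_pos (by positivity : (0:ℝ) < N * √(Real.log N)), div_le_iff₀ (by positivity)]
    refine (hC N).trans (le_of_eq ?_)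
    field_simp
  have := hdiff.add hLw
  rw [zero_add] at this
  refine this.congr fun N => ?_
  ring

end partD

section partE
open Filter Asymptotics MeasureTheory Set Topology

section karamata

/-- The Karamata functional. -/
noncomputable def kT (a : ℕ → ℝ) (φ : ℝ → ℝ) (δ : ℝ) : ℝ :=
  √δ * ∑' n : ℕ, a n * (n:ℝ) ^ (-δ) * φ ((n:ℝ) ^ (-δ))

noncomputable def kW (t : ℝ) : ℝ := Real.exp (-t) * t ^ ((1/2 : ℝ) - 1)

noncomputable def kI (φ : ℝ → ℝ) : ℝ := ∫ t in Ioi (0:ℝ), kW t * φ (Real.exp (-t))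

lemma kW_int : IntegrableOn kW (Ioi 0) := Real.GammaIntegral_convergent (s := 1/2) (by norm_num)

lemma kW_nonneg (t : ℝ) (ht : 0 < t) : 0 ≤ kW t := by unfold kW; positivity

lemma kW_phi_int (φ : ℝ → ℝ) (hφ : Measurable φ) (B : ℝ) (hB : ∀ y ∈ Icc (0:ℝ) 1, |φ y| ≤ B) :
    IntegrableOn (fun t => kW t * φ (Real.exp (-t))) (Ioi 0) := by
  refine kW_int.mul_bdd (c := B) ?_ ?_
  · apply Measurable.aestronglyMeasurable; fun_prop
  · filter_upwards [ae_restrict_mem measurableSet_Ioi] with t (ht : 0 < t)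
    exact hB _ ⟨Real.exp_nonneg _, Real.exp_le_one_iff.2 (by linarith)⟩

lemma kI_pow (k : ℕ) : kI (fun y => y ^ k) = √Real.pi / √((k:ℝ) + 1) := by
  unfold kI kW
  have h := Real.integral_rpow_mul_exp_neg_mul_Ioi (a := 1/2) (r := (k:ℝ) + 1) (by norm_num) (by positivity)
  have e : ∀ t : ℝ, Real.exp (-t) * t ^ ((1/2:ℝ) - 1) * Real.exp (-t) ^ k = t ^ ((1/2:ℝ) - 1) * Real.exp (-(((k:ℝ) + 1) * t)) := by
    intro t
    rw [← Real.exp_nat_mul, show -(((k:ℝ) + 1) * t) = -t + k * (-t) by ring, Real.exp_add]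
    ring
  simp_rw [e]
  rw [h, Real.Gamma_one_half_eq, ← Real.sqrt_eq_rpow, Real.sqrt_div zero_le_one, Real.sqrt_one]
  ring

variable {a : ℕ → ℝ} (ha : ∀ n, 0 ≤ a n) (ha0 : a 0 = 0)
  (hsum : ∀ δ : ℝ, 0 < δ → Summable (fun n : ℕ => a n * (n:ℝ) ^ (-δ)))

lemma y_mem (n : ℕ) (δ : ℝ) (hδ : 0 < δ) : (n:ℝ) ^ (-δ) ∈ Icc (0:ℝ) 1 := by
  constructor
  · positivity
  · rcases Nat.eq_zero_or_pos n with rfl | hn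
    · simp [Real.zero_rpow (by linarith : -δ ≠ 0)]
    · exact Real.rpow_le_one_of_one_le_of_nonpos (by exact_mod_cast hn) (by linarith)

include ha hsum in
lemma kT_summable (φ : ℝ → ℝ) (B : ℝ) (hB : ∀ y ∈ Icc (0:ℝ) 1, |φ y| ≤ B) (δ : ℝ) (hδ : 0 < δ) :
    Summable (fun n : ℕ => a n * (n:ℝ) ^ (-δ) * φ ((n:ℝ) ^ (-δ))) := by
  refine Summable.of_norm_bounded ((hsum δ hδ).mul_right B) ?_
  intro n
  have h1 : 0 ≤ a n * (n:ℝ) ^ (-δ) := mul_nonneg (ha n) (by positivity)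
  rw [norm_mul, Real.norm_of_nonneg h1]
  exact mul_le_mul_of_nonneg_left (hB _ (y_mem n δ hδ)) h1

include ha hsum in
lemma kT_mono (φ₁ φ₂ : ℝ → ℝ) (B : ℝ) (hB1 : ∀ y ∈ Icc (0:ℝ) 1, |φ₁ y| ≤ B) (hB2 : ∀ y ∈ Icc (0:ℝ) 1, |φ₂ y| ≤ B)
    (h : ∀ y ∈ Icc (0:ℝ) 1, φ₁ y ≤ φ₂ y) (δ : ℝ) (hδ : 0 < δ) : kT a φ₁ δ ≤ kT a φ₂ δ := by
  unfold kT
  apply mul_le_mul_of_nonneg_left _ (Real.sqrt_nonneg _)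
  refine (kT_summable ha hsum φ₁ B hB1 δ hδ).tsum_le_tsum ?_ (kT_summable ha hsum φ₂ B hB2 δ hδ)
  intro n
  exact mul_le_mul_of_nonneg_left (h _ (y_mem n δ hδ)) (mul_nonneg (ha n) (by positivity))

include ha hsum in
lemma kT_add (φ₁ φ₂ : ℝ → ℝ) (B1 B2 : ℝ) (hB1 : ∀ y ∈ Icc (0:ℝ) 1, |φ₁ y| ≤ B1) (hB2 : ∀ y ∈ Icc (0:ℝ) 1, |φ₂ y| ≤ B2)
    (δ : ℝ) (hδ : 0 < δ) : kT a (fun y => φ₁ y + φ₂ y) δ = kT a φ₁ δ + kT a φ₂ δ := by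
  unfold kT
  rw [← mul_add, ← (kT_summable ha hsum φ₁ B1 hB1 δ hδ).tsum_add (kT_summable ha hsum φ₂ B2 hB2 δ hδ)]
  simp_rw [mul_add]

lemma kT_const_mul (φ : ℝ → ℝ) (r δ : ℝ) : kT a (fun y => r * φ y) δ = r * kT a φ δ := by
  unfold kT
  have : ∀ n : ℕ, a n * (n:ℝ) ^ (-δ) * (r * φ ((n:ℝ) ^ (-δ))) = r * (a n * (n:ℝ) ^ (-δ) * φ ((n:ℝ) ^ (-δ))) := fun n => by ring
  simp_rw [this]
  rw [tsum_mul_left]; ring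

lemma poly_bdd (P : Polynomial ℝ) : ∃ B, ∀ y ∈ Icc (0:ℝ) 1, |P.eval y| ≤ B := 
  isCompact_Icc.exists_bound_of_continuousOn P.continuous.continuousOn

variable {c : ℝ} (hc : Tendsto (fun δ : ℝ => √δ * ∑' n : ℕ, a n * (n:ℝ) ^ (-δ)) (𝓝[>] 0) (𝓝 c))

include hc ha0 in
lemma kT_pow (k : ℕ) : Tendsto (kT a (fun y => y ^ k)) (𝓝[>] 0) (𝓝 (c / √Real.pi * kI (fun y => y ^ k))) := by
  have hk : (0:ℝ) < (k:ℝ) + 1 := by positivity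
  have ht : Tendsto (fun δ : ℝ => ((k:ℝ) + 1) * δ) (𝓝[>] 0) (𝓝[>] 0) := by
    apply tendsto_nhdsWithin_of_tendsto_nhds_of_eventually_within
    · have : Continuous (fun δ : ℝ => ((k:ℝ) + 1) * δ) := by fun_prop
      have := this.tendsto 0
      rw [mul_zero] at this
      exact this.mono_left nhdsWithin_le_nhds
    · filter_upwards [self_mem_nhdsWithin] with δ (hδ : 0 < δ)
      exact mul_pos hk hδ
  have h := (hc.comp ht).const_mul (1 / √((k:ℝ) + 1))
  rw [kI_pow]
  have e : c / √Real.pi * (√Real.pi / √((k:ℝ) + 1)) = 1 / √((k:ℝ) + 1) * c := by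
    have : 0 < √Real.pi := Real.sqrt_pos.2 Real.pi_pos
    field_simp
  rw [e]
  refine h.congr' ?_
  filter_upwards [self_mem_nhdsWithin] with δ (hδ : 0 < δ)
  simp only [Function.comp, kT]
  rw [Real.sqrt_mul hk.le]
  have hs : 0 < √((k:ℝ) + 1) := Real.sqrt_pos.2 hk
  rw [← mul_assoc, ← mul_assoc, one_div, inv_mul_cancel₀ hs.ne', one_mul]
  congr 1
  apply tsum_congr
  intro n
  rcases Nat.eq_zero_or_pos n with rfl | hn
  · simp [ha0]
  have hn' : (0:ℝ) < n := by exact_mod_cast hn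
  rw [← Real.rpow_natCast, ← Real.rpow_mul hn'.le, mul_assoc, ← Real.rpow_add hn']
  congr 2; ring

include ha hsum hc ha0 in
lemma kT_poly (P : Polynomial ℝ) : Tendsto (kT a (fun y => P.eval y)) (𝓝[>] 0) (𝓝 (c / √Real.pi * kI (fun y => P.eval y))) := by
  induction P using Polynomial.induction_on' with
  | add p q hp hq =>
    obtain ⟨B1, hB1⟩ := poly_bdd p
    obtain ⟨B2, hB2⟩ := poly_bdd q
    have e : kI (fun y => (p + q).eval y) = kI (fun y => p.eval y) + kI (fun y => q.eval y) := by
      unfold kI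
      rw [← integral_add (kW_phi_int _ p.continuous.measurable B1 hB1) (kW_phi_int _ q.continuous.measurable B2 hB2)]
      simp_rw [Polynomial.eval_add, mul_add]
    rw [e, mul_add]
    refine (hp.add hq).congr' ?_
    filter_upwards [self_mem_nhdsWithin] with δ (hδ : 0 < δ)
    simp_rw [Polynomial.eval_add]
    exact (kT_add ha hsum _ _ B1 B2 hB1 hB2 δ hδ).symm
  | monomial k r =>
    simp_rw [Polynomial.eval_monomial]
    have e : kI (fun y => r * y ^ k) = r * kI (fun y => y ^ k) := by
      unfold kI
      rw [← integral_const_mul]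
      congr 1; ext t; ring
    rw [e, mul_left_comm]
    refine ((kT_pow ha0 hc k).const_mul r).congr fun δ => ?_
    exact (kT_const_mul (fun y => y ^ k) r δ).symm

include ha hsum hc ha0 in
lemma kT_cont (φ : ℝ → ℝ) (hφ : Continuous φ) : Tendsto (kT a φ) (𝓝[>] 0) (𝓝 (c / √Real.pi * kI φ)) := by
  obtain ⟨B0, hB0⟩ := isCompact_Icc.exists_bound_of_continuousOn (hφ.continuousOn (s := Icc (0:ℝ) 1))
  have hc0 : 0 ≤ c := by
    refine ge_of_tendsto hc ?_
    filter_upwards with δ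
    exact mul_nonneg (Real.sqrt_nonneg _) (tsum_nonneg fun n => mul_nonneg (ha n) (by positivity))
  have hpi : 0 < √Real.pi := Real.sqrt_pos.2 Real.pi_pos
  have h1 : Tendsto (kT a (fun _ => 1)) (𝓝[>] 0) (𝓝 c) := by
    refine hc.congr fun δ => ?_
    simp [kT]
  have hI1 : kI (fun _ => 1) = √Real.pi := by
    have := kI_pow 0
    simpa using this
  -- approximations
  have key : ∀ ε > 0, ∃ u v : ℝ, (∀ᶠ δ in 𝓝[>] (0:ℝ), u ≤ kT a φ δ ∧ kT a φ δ ≤ v) ∧ 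
      c / √Real.pi * kI φ - (2 * c + 2) * ε ≤ u ∧ v ≤ c / √Real.pi * kI φ + (2 * c + 2) * ε := by
    intro ε hε
    obtain ⟨P, hP⟩ := exists_polynomial_near_of_continuousOn 0 1 φ hφ.continuousOn ε hε
    obtain ⟨B1, hB1⟩ := poly_bdd P
    have hp := kT_poly ha ha0 hsum hc P
    have hI : |kI φ - kI (fun y => P.eval y)| ≤ ε * √Real.pi := by
      rw [← hI1]
      unfold kI
      rw [← integral_sub (kW_phi_int _ hφ.measurable B0 hB0) (kW_phi_int _ P.continuous.measurable B1 hB1), ← integral_const_mul]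
      rw [← Real.norm_eq_abs]
      have hb : IntegrableOn (fun t => ε * (kW t * (fun _ : ℝ => (1:ℝ)) (Real.exp (-t)))) (Ioi 0) :=
        (kW_phi_int (fun _ => 1) measurable_const 1 (by simp)).const_mul ε
      refine norm_integral_le_of_norm_le hb ?_
      filter_upwards [ae_restrict_mem measurableSet_Ioi] with t (ht : 0 < t)
      rw [← mul_sub, norm_mul, Real.norm_of_nonneg (kW_nonneg t ht)]
      have := hP (Real.exp (-t)) ⟨Real.exp_nonneg _, Real.exp_le_one_iff.2 (by linarith)⟩
      rw [abs_sub_comm] at this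
      calc kW t * ‖φ (Real.exp (-t)) - P.eval (Real.exp (-t))‖ ≤ kW t * ε := 
            mul_le_mul_of_nonneg_left this.le (kW_nonneg t ht)
        _ = _ := by ring
    have hI' : |c / √Real.pi * kI φ - c / √Real.pi * kI (fun y => P.eval y)| ≤ c * ε := by
      rw [← mul_sub, abs_mul, abs_of_nonneg (div_nonneg hc0 hpi.le)]
      calc _ ≤ c / √Real.pi * (ε * √Real.pi) := by gcongr
        _ = _ := by field_simp
    rw [abs_le] at hI'
    refine ⟨c / √Real.pi * kI (fun y => P.eval y) - ε - (c + 1) * ε, c / √Real.pi * kI (fun y => P.eval y) + ε + (c + 1) * ε, ?_, by linarith [hI'.1, hI'.2], by linarith [hI'.1, hI'.2]⟩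
    have hpl := hp.eventually (Ioo_mem_nhds (a := c / √Real.pi * kI (fun y => P.eval y) - ε) (b := c / √Real.pi * kI (fun y => P.eval y) + ε) (by linarith) (by linarith))
    have h1l := h1.eventually (gt_mem_nhds (show c < c + 1 by linarith))
    filter_upwards [hpl, h1l, self_mem_nhdsWithin] with δ hpδ h1δ (hδ : 0 < δ)
    have hB1' : ∀ y ∈ Icc (0:ℝ) 1, |ε * (1:ℝ)| ≤ ε := by intro y _; rw [mul_one, abs_of_pos hε]
    have hB0' : ∀ y ∈ Icc (0:ℝ) 1, |φ y| ≤ B0 := hB0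
    have hsumb : ∀ y ∈ Icc (0:ℝ) 1, |P.eval y + ε * 1| ≤ B0 + B1 + ε := by
      intro y hy
      refine (abs_add_le _ _).trans ?_
      linarith [hB1 y hy, hB1' y hy, (abs_nonneg _).trans (hB0' y hy)]
    have hsumc : ∀ y ∈ Icc (0:ℝ) 1, |φ y + ε * 1| ≤ B0 + B1 + ε := by
      intro y hy
      refine (abs_add_le _ _).trans ?_
      linarith [hB0' y hy, hB1' y hy, (abs_nonneg _).trans (hB1 y hy)]
    have m1 := kT_mono ha hsum φ (fun y => P.eval y + ε * 1) (B0 + B1 + ε) 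
      (fun y hy => by linarith [hB0' y hy, (abs_nonneg _).trans (hB1 y hy)]) hsumb
      (fun y hy => by have := abs_lt.1 (hP y hy); linarith [this.1]) δ hδ
    have m2 := kT_mono ha hsum (fun y => P.eval y) (fun y => φ y + ε * 1) (B0 + B1 + ε) 
      (fun y hy => by linarith [hB1 y hy, (abs_nonneg _).trans (hB0' y hy)]) hsumc
      (fun y hy => by have := abs_lt.1 (hP y hy); linarith [this.2]) δ hδ
    rw [kT_add ha hsum _ _ B1 ε hB1 hB1' δ hδ, kT_const_mul] at m1
    rw [kT_add ha hsum _ _ B0 ε hB0' hB1' δ hδ, kT_const_mul] at m2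
    have : ε * kT a (fun _ => 1) δ ≤ ε * (c + 1) := by gcongr
    constructor <;> nlinarith [hpδ.1, hpδ.2]
  rw [tendsto_order]
  constructor
  · intro b hb
    have hε : 0 < (c / √Real.pi * kI φ - b) / (2 * (2 * c + 2)) := by
      apply div_pos <;> linarith
    obtain ⟨u, v, hev, hu, hv⟩ := key _ hε
    filter_upwards [hev] with δ hδ
    refine lt_of_lt_of_le (lt_of_lt_of_le ?_ hu) hδ.1
    have : (2 * c + 2) * ((c / √Real.pi * kI φ - b) / (2 * (2 * c + 2))) = (c / √Real.pi * kI φ - b) / 2 := by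
      have : (2 * c + 2) ≠ 0 := by linarith
      rw [mul_div_assoc', mul_comm 2 (2 * c + 2), mul_div_mul_left _ _ this]
    rw [this]; linarith
  · intro b hb
    have hε : 0 < (b - c / √Real.pi * kI φ) / (2 * (2 * c + 2)) := by
      apply div_pos <;> linarith
    obtain ⟨u, v, hev, hu, hv⟩ := key _ hε
    filter_upwards [hev] with δ hδ
    refine lt_of_le_of_lt (hδ.2.trans hv) ?_
    have : (2 * c + 2) * ((b - c / √Real.pi * kI φ) / (2 * (2 * c + 2))) = (b - c / √Real.pi * kI φ) / 2 := by
      have : (2 * c + 2) ≠ 0 := by linarith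
      rw [mul_div_assoc', mul_comm 2 (2 * c + 2), mul_div_mul_left _ _ this]
    rw [this]; linarith

noncomputable def kg (y : ℝ) : ℝ := if Real.exp (-1) ≤ y then 1 / max y (Real.exp (-1)) else 0
noncomputable def kphi (b : ℝ) (j : ℕ) (y : ℝ) : ℝ := max 0 (min 1 (b + j * (y - Real.exp (-1)))) / max y (Real.exp (-1))

lemma kphi_cont (b : ℝ) (j : ℕ) : Continuous (kphi b j) := by
  unfold kphi
  apply Continuous.div (by fun_prop) (by fun_prop)
  intro y
  exact (lt_of_lt_of_le (Real.exp_pos (-1)) (le_max_right _ _)).ne'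

lemma kphi_bdd (b : ℝ) (j : ℕ) (y : ℝ) : |kphi b j y| ≤ Real.exp 1 := by
  unfold kphi
  have h0 := Real.exp_pos (-1)
  have h1 : 0 < max y (Real.exp (-1)) := (lt_of_lt_of_le h0 (le_max_right _ _))
  have h2 : max 0 (min 1 (b + j * (y - Real.exp (-1)))) ≤ 1 := max_le zero_le_one (min_le_left _ _)
  rw [abs_of_nonneg (div_nonneg (le_max_left _ _) h1.le), div_le_iff₀ h1]
  calc _ ≤ 1 := h2
    _ = Real.exp 1 * Real.exp (-1) := by rw [← Real.exp_add]; simp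
    _ ≤ _ := by gcongr; exact le_max_right _ _

lemma kphi_lim (b : ℝ) (y : ℝ) (hy : y ≠ Real.exp (-1)) : Tendsto (fun j => kphi b j y) atTop (𝓝 (kg y)) := by
  apply tendsto_const_nhds.congr'
  unfold kphi kg
  rcases lt_or_gt_of_ne hy with h | h
  · have ht : Tendsto (fun j : ℕ => b + j * (y - Real.exp (-1))) atTop atBot :=
      tendsto_atBot_add_const_left _ _ (tendsto_natCast_atTop_atTop.atTop_mul_const_of_neg (by linarith))
    filter_upwards [ht.eventually (eventually_le_atBot 0)] with j hj
    rw [if_neg (by linarith), max_eq_left ((min_le_right _ _).trans hj), zero_div]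
  · have ht : Tendsto (fun j : ℕ => b + j * (y - Real.exp (-1))) atTop atTop :=
      tendsto_atTop_add_const_left _ _ (tendsto_natCast_atTop_atTop.atTop_mul_const (by linarith))
    filter_upwards [ht.eventually (eventually_ge_atTop 1)] with j hj
    rw [if_pos h.le, min_eq_left hj, max_eq_right zero_le_one]

lemma kI_kphi_lim (b : ℝ) : Tendsto (fun j => kI (kphi b j)) atTop (𝓝 (kI kg)) := by
  unfold kI
  apply tendsto_integral_of_dominated_convergence (fun t => kW t * Real.exp 1)
  · intro j
    exact (kW_phi_int _ (kphi_cont b j).measurable _ (fun y _ => kphi_bdd b j y)).aestronglyMeasurable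
  · exact kW_int.mul_const _
  · intro j
    filter_upwards [ae_restrict_mem measurableSet_Ioi] with t (ht : 0 < t)
    rw [norm_mul, Real.norm_of_nonneg (kW_nonneg t ht)]
    exact mul_le_mul_of_nonneg_left (kphi_bdd b j _) (kW_nonneg t ht)
  · have : ∀ᵐ t ∂(volume.restrict (Ioi (0:ℝ))), t ≠ 1 := by
      apply ae_restrict_of_ae
      simp [ae_iff]
    filter_upwards [this] with t ht
    apply (kphi_lim b _ _).const_mul
    intro h
    have := Real.exp_injective h
    exact ht (by linarith)

lemma kI_kg : kI kg = 2 := by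
  unfold kI
  have : ∀ t ∈ Ioi (0:ℝ), kW t * kg (Real.exp (-t)) = indicator (Ioc 0 1) (fun t => t ^ (-(1/2) : ℝ)) t := by
    intro t ht
    have ht0 : 0 < t := ht
    unfold kW kg
    by_cases h : t ≤ 1
    · have h2 : Real.exp (-1) ≤ Real.exp (-t) := Real.exp_le_exp.2 (by linarith)
      rw [if_pos h2, indicator_of_mem (show t ∈ Ioc (0:ℝ) 1 from ⟨ht0, h⟩), max_eq_left h2]
      have := Real.exp_pos (-t)
      field_simp
      norm_num
    · have h2 : ¬ Real.exp (-1) ≤ Real.exp (-t) := by rw [Real.exp_le_exp]; linarith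
      rw [if_neg h2, indicator_of_notMem (fun h' => h h'.2), mul_zero]
  rw [setIntegral_congr_fun measurableSet_Ioi this, setIntegral_indicator measurableSet_Ioc,
    inter_eq_self_of_subset_right Ioc_subset_Ioi_self, ← intervalIntegral.integral_of_le zero_le_one,
    integral_rpow (Or.inl (by norm_num))]
  norm_num

include ha hsum hc ha0 in
theorem karamata : Tendsto (fun N : ℕ => (∑ n ∈ Finset.Icc 1 N, a n) / √(Real.log N)) atTop (𝓝 (2 * c / √Real.pi)) := by
  have hδ : Tendsto (fun N : ℕ => 1 / Real.log N) atTop (𝓝[>] 0) := by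
    apply tendsto_nhdsWithin_of_tendsto_nhds_of_eventually_within
    · exact tendsto_const_nhds.div_atTop (Real.tendsto_log_atTop.comp tendsto_natCast_atTop_atTop)
    · filter_upwards [eventually_ge_atTop 2] with N hN
      have : 0 < Real.log N := Real.log_pos (by exact_mod_cast (by omega : 1 < N))
      exact one_div_pos.2 this
  have hkg : ∀ y ∈ Icc (0:ℝ) 1, |kg y| ≤ Real.exp 1 := by
    intro y _
    unfold kg
    split_ifs with h
    · have := kphi_bdd 1 0 y
      unfold kphi at this
      simpa using this
    · simp [Real.exp_nonneg]
  have e : ∀ᶠ N : ℕ in atTop, kT a kg (1 / Real.log N) = (∑ n ∈ Finset.Icc 1 N, a n) / √(Real.log N) := by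
    filter_upwards [eventually_ge_atTop 2] with N hN
    have hl : 0 < Real.log N := Real.log_pos (by exact_mod_cast (by omega : 1 < N))
    unfold kT
    rw [tsum_eq_sum (s := Finset.Icc 1 N)]
    · rw [Real.sqrt_div zero_le_one, Real.sqrt_one, div_mul_eq_mul_div, one_mul]
      congr 1
      apply Finset.sum_congr rfl
      intro n hn
      rw [Finset.mem_Icc] at hn
      have hn' : (0:ℝ) < n := by exact_mod_cast hn.1
      have hle : Real.log n ≤ Real.log N := Real.log_le_log hn' (by exact_mod_cast hn.2)
      have h2 : Real.exp (-1) ≤ (n:ℝ) ^ (-(1 / Real.log N)) := by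
        rw [Real.rpow_def_of_pos hn', Real.exp_le_exp]
        rw [mul_neg, neg_le_neg_iff, mul_one_div, div_le_one hl]; exact hle
      unfold kg
      rw [if_pos h2, max_eq_left h2]
      have : 0 < (n:ℝ) ^ (-(1 / Real.log N)) := by positivity
      field_simp
    · intro n hn
      rcases Nat.eq_zero_or_pos n with rfl | hn0
      · simp [ha0]
      have hnN : N < n := by
        by_contra h
        exact hn (Finset.mem_Icc.2 ⟨hn0, not_lt.1 h⟩)
      have hn' : (0:ℝ) < n := by exact_mod_cast hn0
      have hlt : Real.log N < Real.log n := Real.log_lt_log (by exact_mod_cast (by omega : 0 < N)) (by exact_mod_cast hnN)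
      have h2 : ¬ Real.exp (-1) ≤ (n:ℝ) ^ (-(1 / Real.log N)) := by
        rw [Real.rpow_def_of_pos hn', Real.exp_le_exp]
        rw [mul_neg, neg_le_neg_iff, mul_one_div, div_le_one hl]; exact not_le.2 hlt
      unfold kg
      rw [if_neg h2, mul_zero]
  have main : Tendsto (kT a kg) (𝓝[>] 0) (𝓝 (c / √Real.pi * kI kg)) := by
    rw [tendsto_order]
    have hlim : ∀ b, Tendsto (fun j => c / √Real.pi * kI (kphi b j)) atTop (𝓝 (c / √Real.pi * kI kg)) := 
      fun b => (kI_kphi_lim b).const_mul _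
    have hmax : ∀ y, 0 < max y (Real.exp (-1)) := fun y => (lt_of_lt_of_le (Real.exp_pos _) (le_max_right _ _))
    constructor
    · intro r hr
      obtain ⟨j, hj⟩ := ((hlim 0).eventually (lt_mem_nhds hr)).exists
      filter_upwards [(kT_cont ha ha0 hsum hc (kphi 0 j) (kphi_cont 0 j)).eventually (lt_mem_nhds hj), self_mem_nhdsWithin] with δ h1 (hδ : 0 < δ)
      refine h1.trans_le (kT_mono ha hsum _ _ (Real.exp 1) (fun y _ => kphi_bdd 0 j y) hkg ?_ δ hδ)
      intro y _
      unfold kphi kg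
      split_ifs with h
      · have := hmax y
        gcongr
        exact max_le zero_le_one (min_le_left _ _)
      · rw [max_eq_left, zero_div]
        refine (min_le_right _ _).trans ?_
        have : (0:ℝ) ≤ j := Nat.cast_nonneg j
        nlinarith
    · intro r hr
      obtain ⟨j, hj⟩ := ((hlim 1).eventually (gt_mem_nhds hr)).exists
      filter_upwards [(kT_cont ha ha0 hsum hc (kphi 1 j) (kphi_cont 1 j)).eventually (gt_mem_nhds hj), self_mem_nhdsWithin] with δ h1 (hδ : 0 < δ)
      refine lt_of_le_of_lt (kT_mono ha hsum _ _ (Real.exp 1) hkg (fun y _ => kphi_bdd 1 j y) ?_ δ hδ) h1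
      intro y _
      unfold kphi kg
      split_ifs with h
      · have := hmax y
        gcongr
        refine le_trans (le_min le_rfl ?_) (le_max_right _ _)
        have : 0 ≤ (j:ℝ) * (y - Real.exp (-1)) := mul_nonneg (Nat.cast_nonneg j) (by linarith)
        linarith
      · exact div_nonneg (le_max_left _ _) (hmax y).le
  rw [kI_kg] at main
  have := (main.comp hδ).congr' e
  convert! this using 2
  ring

end karamata

end partE

section partF
open Filter Asymptotics MeasureTheory Set Topology

lemma jac_iff (p : ℕ) (hp : p.Prime) : jacobiSym 2 p = 1 ↔ (p % 8 = 1 ∨ p % 8 = 7) := by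
  rcases hp.eq_two_or_odd' with rfl | h
  · constructor
    · intro h; exfalso
      have : jacobiSym 2 2 = 0 := by
        rw [jacobiSym.eq_zero_iff]; exact ⟨by norm_num, by decide⟩
      rw [this] at h
      norm_num at h
    · intro h; omega
  · rw [jacobiSym.at_two h, ZMod.χ₈_nat_eq_if_mod_eight]
    have := Nat.odd_iff.1 h
    rw [if_neg (by omega)]
    split_ifs with h1
    · simp [h1]
    · simp [h1]

lemma goodN_prime (p : ℕ) (hp : p.Prime) : goodN p ↔ jacobiSym 2 p = 1 := by
  constructor
  · intro h; exact h.2 p hp dvd_rfl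
  · intro h
    refine ⟨hp.squarefree, fun q hq hqp => ?_⟩
    rw [(Nat.prime_dvd_prime_iff_eq hq hp).1 hqp]; exact h

lemma zmod8_iff (p r : ℕ) (hr : r < 8) : (p : ZMod 8) = (r : ZMod 8) ↔ p % 8 = r := by
  rw [ZMod.natCast_eq_natCast_iff, Nat.ModEq, Nat.mod_eq_of_lt hr]

lemma Th_eq (χ : ℕ → ℝ) (u v : ℝ) (h1 : ∀ n, n % 8 = 1 → χ n = u) (h7 : ∀ n, n % 8 = 7 → χ n = v) (x : ℝ) :
    Th χ ⌊x⌋₊ = u * thetaAP (1 : ZMod 8) x + v * thetaAP (7 : ZMod 8) x := by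
  unfold Th thetaAP
  rw [Finset.mul_sum, Finset.mul_sum, ← Finset.sum_add_distrib]
  apply Finset.sum_congr rfl
  intro p _
  have e1 := zmod8_iff p 1 (by norm_num)
  have e7 := zmod8_iff p 7 (by norm_num)
  push_cast at e1 e7
  simp only [e1, e7]
  by_cases hp : p.Prime
  · simp only [hp, true_and, if_true]
    unfold fI
    rw [goodN_prime p hp, jac_iff p hp]
    by_cases a : p % 8 = 1
    · simp [a, h1 p a]
    · by_cases b : p % 8 = 7
      · simp [b, h7 p b]
      · simp [a, b]
  · simp [hp]

lemma Th_tendsto (χ : ℕ → ℝ) (u v : ℝ) (h1 : ∀ n, n % 8 = 1 → χ n = u) (h7 : ∀ n, n % 8 = 7 → χ n = v) :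
    Tendsto (fun x : ℝ => Th χ ⌊x⌋₊ / x) atTop (𝓝 ((u + v) / 4)) := by
  have a := (thetaAP_tendsto (1 : ZMod 8) isUnit_one).const_mul u
  have b := (thetaAP_tendsto (7 : ZMod 8) (by decide)).const_mul v
  have h := a.add b
  have ht : Nat.totient 8 = 4 := by decide
  rw [ht] at h
  convert h using 1
  · ext x
    rw [Th_eq χ u v h1 h7]; ring
  · congr 1; push_cast; ring

noncomputable def chi4 (n : ℕ) : ℝ := ((ZMod.χ₄ (n : ZMod 4) : ℤ) : ℝ)

lemma chi4_val (n : ℕ) : chi4 n = if n % 2 = 0 then 0 else if n % 4 = 1 then 1 else -1 := by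
  unfold chi4
  rw [ZMod.χ₄_nat_eq_if_mod_four]
  push_cast
  rfl

/-- Dirichlet series of fI. -/
noncomputable def DS (s : ℝ) : ℝ := ∑' n : ℕ, fI n * (n:ℝ) ^ (-s)

lemma DS_summable (s : ℝ) (hs : 1 < s) : Summable (fun n : ℕ => fI n * (n:ℝ) ^ (-s)) := by
  refine Summable.of_nonneg_of_le (fun n => mul_nonneg (fI_nonneg n) (by positivity)) (fun n => ?_)
    (Real.summable_nat_rpow.2 (show -s < -1 by linarith))
  exact mul_le_of_le_one_left (by positivity) (fI_le_one n)

lemma fI_zero : fI 0 = 0 := fI_eq_zero (by simp)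

lemma fI_one : fI 1 = 1 := by
  unfold fI
  rw [if_pos]
  refine ⟨squarefree_one, fun p hp h => ?_⟩
  exact absurd (Nat.dvd_one.1 h) hp.one_lt.ne'

lemma DS_local (s : ℝ) (p : ℕ) (hp : p.Prime) :
    ∑' e : ℕ, fI (p ^ e) * ((p ^ e : ℕ):ℝ) ^ (-s) = 1 + fI p * (p:ℝ) ^ (-s) := by
  rw [tsum_eq_sum (s := Finset.range 2)]
  · rw [Finset.sum_range_succ, Finset.sum_range_succ]
    simp [fI_one]
  · intro e he
    rw [Finset.mem_range, not_lt] at he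
    rw [fI_eq_zero, zero_mul]
    intro h
    rw [Nat.squarefree_pow_iff hp.one_lt.ne' (by omega)] at h
    omega

open Classical in
noncomputable def gP (n : ℕ) : ℝ := if (n.Prime ∧ (n = 2 ∨ jacobiSym 2 n = 1)) then 1 else 0

open Classical in
lemma ES_hasProd (s : ℝ) (hs : 1 < s) :
    HasProd (fun n : ℕ => 1 + gP n * (n:ℝ) ^ (-s)) ((1 + (2:ℝ) ^ (-s)) * DS s) := by
  have h := EulerProduct.eulerProduct_hasProd_mulIndicator (f := fun n : ℕ => fI n * (n:ℝ) ^ (-s))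
    (by simp [fI_one]) (fun {m n} hmn => by
      rw [fI_mul hmn]; push_cast; rw [Real.mul_rpow (by positivity) (by positivity)]; ring)
    (DS_summable s hs).norm (by simp [fI_zero])
  have h2 : HasProd (fun n : ℕ => if n = 2 then 1 + (2:ℝ) ^ (-s) else 1) (1 + (2:ℝ) ^ (-s)) := by
    have := hasProd_ite_eq (α := ℝ) 2 (1 + (2:ℝ) ^ (-s))
    exact this
  have := h2.mul h
  change HasProd _ ((1 + (2:ℝ) ^ (-s)) * ∑' n : ℕ, fI n * (n:ℝ) ^ (-s))
  convert this using 1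
  ext n
  by_cases hn : n.Prime
  · rw [mulIndicator_of_mem (show n ∈ {p : ℕ | p.Prime} from hn), DS_local s n hn]
    unfold gP fI
    rw [goodN_prime n hn]
    by_cases h2 : n = 2
    · subst h2
      have hj : ¬ jacobiSym 2 2 = 1 := by rw [jac_iff 2 hn]; norm_num
      simp [Nat.prime_two, hj]
    · simp [h2, hn]
  · rw [mulIndicator_of_notMem (show n ∉ {p : ℕ | p.Prime} from hn)]
    have h2 : n ≠ 2 := by rintro rfl; exact hn Nat.prime_two
    simp [gP, hn, h2]

open Classical in
lemma ES_tprod (s : ℝ) (hs : 1 < s) :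
    ∏' p : {p : ℕ // p.Prime ∧ (p = 2 ∨ jacobiSym 2 p = 1)}, (1 + (p.1 : ℝ) ^ (-s)) = (1 + (2:ℝ) ^ (-s)) * DS s := by
  apply HasProd.tprod_eq
  change HasProd ((fun n : ℕ => 1 + (n : ℝ) ^ (-s)) ∘ Subtype.val (p := (· ∈ {p : ℕ | p.Prime ∧ (p = 2 ∨ jacobiSym 2 p = 1)}))) _
  rw [hasProd_subtype_iff_mulIndicator]
  convert ES_hasProd s hs using 1
  ext n
  unfold gP
  by_cases h : (n.Prime ∧ (n = 2 ∨ jacobiSym 2 n = 1))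
  · rw [mulIndicator_of_mem (by exact h), if_pos h, one_mul]
  · rw [mulIndicator_of_notMem (by exact h), if_neg h]; simp

lemma ES_primes (s : ℝ) (hs : 1 < s) :
    HasProd (fun n : Nat.Primes => 1 + gP n * ((n:ℕ):ℝ) ^ (-s)) ((1 + (2:ℝ) ^ (-s)) * DS s) := by
  change HasProd ((fun n : ℕ => 1 + gP n * (n : ℝ) ^ (-s)) ∘ Subtype.val (p := (· ∈ {p : ℕ | p.Prime}))) _
  rw [hasProd_subtype_iff_mulIndicator]
  convert ES_hasProd s hs using 1
  ext n
  by_cases h : n.Prime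
  · rw [mulIndicator_of_mem (by exact h)]
  · rw [mulIndicator_of_notMem (by exact h)]; simp [gP, h]

end partF

section partG
open Filter Asymptotics MeasureTheory Set Topology

noncomputable def chi8 : DirichletCharacter ℂ 8 := ZMod.χ₈.ringHomComp (Int.castRingHom ℂ)

lemma chi8_ne : chi8 ≠ 1 := by
  intro h
  have h3 := congrArg (fun χ : DirichletCharacter ℂ 8 => χ (3 : ZMod 8)) h
  have e : ZMod.χ₈ (3 : ZMod 8) = -1 := by decide
  simp only [chi8, MulChar.ringHomComp_apply, e] at h3
  rw [MulChar.one_apply (by decide)] at h3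
  norm_num at h3

lemma chi8_val (n : ℕ) : chi8 (n : ZMod 8) = (((if n % 2 = 0 then 0 else if n % 8 = 1 ∨ n % 8 = 7 then 1 else -1 : ℤ) : ℝ) : ℂ) := by
  simp only [chi8, MulChar.ringHomComp_apply]
  rw [ZMod.χ₈_nat_eq_if_mod_eight, Complex.ofReal_intCast]
  rfl

lemma local_ineq (s : ℝ) (hs : 1 < s) (p : ℕ) (hp : p.Prime) :
    ‖(1 - (p:ℂ) ^ (-(s:ℂ)))⁻¹‖ * ‖(1 - chi8 (p : ZMod 8) * (p:ℂ) ^ (-(s:ℂ)))⁻¹‖ ≤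
    (1 + gP p * (p:ℝ) ^ (-s)) ^ 2 * ‖(1 - (p:ℂ) ^ (-((2 * s : ℝ):ℂ)))⁻¹‖ ^ 2 := by
  have hp0 : (0:ℝ) < p := by exact_mod_cast hp.pos
  have hp1 : (1:ℝ) < p := by exact_mod_cast hp.one_lt
  set x : ℝ := (p:ℝ) ^ (-s) with hx
  have hx0 : 0 < x := by positivity
  have hx1 : x < 1 := Real.rpow_lt_one_of_one_lt_of_neg hp1 (by linarith)
  have e1 : (p:ℂ) ^ (-(s:ℂ)) = (x:ℂ) := by
    rw [hx, Complex.ofReal_cpow hp0.le]; push_cast; rfl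
  have e2 : (p:ℂ) ^ (-((2 * s : ℝ):ℂ)) = ((x ^ 2 : ℝ):ℂ) := by
    rw [hx, ← Real.rpow_natCast, ← Real.rpow_mul hp0.le, Complex.ofReal_cpow hp0.le]
    congr 1
    push_cast; ring
  rw [e1, e2, chi8_val]
  generalize hc : (((if p % 2 = 0 then 0 else if p % 8 = 1 ∨ p % 8 = 7 then 1 else -1 : ℤ) : ℝ)) = c
  have n1 : ∀ y : ℝ, y < 1 → ‖(1 - (y:ℂ))⁻¹‖ = (1 - y)⁻¹ := by
    intro y hy
    rw [norm_inv, show (1 - (y:ℂ)) = ((1 - y : ℝ) : ℂ) by push_cast; rfl, Complex.norm_real, Real.norm_of_nonneg (by linarith)]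
  have hx2 : x ^ 2 < 1 := by nlinarith
  have hcx : c * x < 1 := by
    have : c ≤ 1 := by rw [← hc]; split_ifs <;> norm_num
    nlinarith
  rw [n1 x hx1, n1 _ hx2, show (c:ℂ) * (x:ℂ) = ((c * x : ℝ) : ℂ) by push_cast; rfl, n1 _ hcx]
  have q1 : 0 < 1 - x := by linarith
  have q2 : 0 < 1 + x := by linarith
  have q3 : 1 - x ^ 2 = (1 - x) * (1 + x) := by ring
  unfold gP
  rcases hp.eq_two_or_odd with rfl | hodd
  · rw [if_pos ⟨hp, Or.inl rfl⟩]
    have : c = 0 := by rw [← hc]; norm_num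
    rw [this, q3]
    have : (1 + 1 * x) ^ 2 * ((1 - x) * (1 + x))⁻¹ ^ 2 = (1 - x)⁻¹ * (1 - x)⁻¹ := by field_simp
    rw [this]
    gcongr
    linarith
  · have hj := jac_iff p hp
    by_cases h : p % 8 = 1 ∨ p % 8 = 7
    · rw [if_pos ⟨hp, Or.inr (hj.2 h)⟩]
      have : c = 1 := by rw [← hc, if_neg (by omega), if_pos h]; norm_num
      rw [this, q3]
      apply le_of_eq
      field_simp
    · rw [if_neg]
      · have : c = -1 := by rw [← hc, if_neg (by omega), if_neg h]; norm_num
        rw [this, q3]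
        have e : (1 - x)⁻¹ * (1 - -1 * x)⁻¹ = ((1 - x) * (1 + x))⁻¹ := by
          rw [mul_inv]; congr 2; ring
        rw [e]
        have : 1 ≤ ((1 - x) * (1 + x))⁻¹ := by
          rw [one_le_inv₀ (by positivity)]; nlinarith
        nlinarith
      · rintro ⟨_, h2 | h2⟩
        · rw [h2] at hodd; norm_num at hodd
        · exact h (hj.1 h2)

lemma hasProd_norm {f : Nat.Primes → ℂ} {z : ℂ} (h : HasProd f z) : 
    Tendsto (fun S : Finset Nat.Primes => ∏ p ∈ S, ‖f p‖) atTop (𝓝 ‖z‖) := by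
  have : Tendsto (fun S : Finset Nat.Primes => ∏ p ∈ S, f p) atTop (𝓝 z) := h
  have := this.norm
  simpa [norm_prod] using this

lemma global_ineq (s : ℝ) (hs : 1 < s) :
    ‖riemannZeta (s:ℂ)‖ * ‖DirichletCharacter.LFunction chi8 (s:ℂ)‖ ≤
    ((1 + (2:ℝ) ^ (-s)) * DS s) ^ 2 * ‖riemannZeta ((2 * s : ℝ):ℂ)‖ ^ 2 := by
  have hs' : 1 < ((s:ℂ)).re := by simpa
  have h1 := hasProd_norm (riemannZeta_eulerProduct_hasProd hs')
  have h2 := hasProd_norm (DirichletCharacter.LSeries_eulerProduct_hasProd chi8 hs')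
  have h3 : Tendsto (fun S : Finset Nat.Primes => ∏ p ∈ S, (1 + gP p * ((p:ℕ):ℝ) ^ (-s))) atTop (𝓝 ((1 + (2:ℝ) ^ (-s)) * DS s)) := ES_primes s hs
  have h4 := hasProd_norm (riemannZeta_eulerProduct_hasProd (s := ((2 * s : ℝ):ℂ)) (by rw [Complex.ofReal_re]; linarith))
  rw [DirichletCharacter.LFunction_eq_LSeries chi8 hs']
  refine le_of_tendsto_of_tendsto' (h1.mul h2) ((h3.pow 2).mul (h4.pow 2)) ?_
  intro S
  rw [← Finset.prod_mul_distrib, ← Finset.prod_pow, ← Finset.prod_pow, ← Finset.prod_mul_distrib]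
  exact Finset.prod_le_prod (fun p _ => by positivity) (fun p _ => local_ineq s hs p p.2)

lemma C_ne_zero (c : ℝ) (h : Tendsto (fun s : ℝ => √(s - 1) * ((1 + (2:ℝ) ^ (-s)) * DS s)) (𝓝[>] 1) (𝓝 c)) : c ≠ 0 := by
  rintro rfl
  have hof : Tendsto (fun s : ℝ => (s:ℂ)) (𝓝[>] 1) (𝓝[≠] (1:ℂ)) := by
    apply tendsto_nhdsWithin_of_tendsto_nhds_of_eventually_within
    · have := (Complex.continuous_ofReal.tendsto 1).mono_left (nhdsWithin_le_nhds (s := Ioi (1:ℝ)))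
      simpa using this
    · filter_upwards [self_mem_nhdsWithin] with s (hs : 1 < s)
      simp only [mem_compl_iff, mem_singleton_iff]
      intro h'
      have : s = 1 := by exact_mod_cast h'
      linarith
  have a1 := (riemannZeta_residue_one.comp hof).norm
  have a2 : Tendsto (fun s : ℝ => ‖DirichletCharacter.LFunction chi8 (s:ℂ)‖) (𝓝[>] 1) (𝓝 ‖DirichletCharacter.LFunction chi8 1‖) :=
    (((DirichletCharacter.differentiable_LFunction chi8_ne).continuous.tendsto 1).comp (hof.mono_right nhdsWithin_le_nhds)).norm
  have a3 : Tendsto (fun s : ℝ => ‖riemannZeta ((2 * s : ℝ):ℂ)‖) (𝓝[>] 1) (𝓝 ‖riemannZeta ((2 * 1 : ℝ):ℂ)‖) := by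
    have hc : ContinuousAt riemannZeta ((2 * 1 : ℝ):ℂ) := (differentiableAt_riemannZeta (by norm_num)).continuousAt
    have : Tendsto (fun s : ℝ => ((2 * s : ℝ):ℂ)) (𝓝[>] 1) (𝓝 ((2 * 1 : ℝ):ℂ)) := 
      ((by fun_prop : Continuous (fun s : ℝ => ((2 * s : ℝ):ℂ))).tendsto 1).mono_left nhdsWithin_le_nhds
    exact (hc.tendsto.comp this).norm
  have l := a1.mul a2
  have r := (h.pow 2).mul (a3.pow 2)
  have := le_of_tendsto_of_tendsto l r (by
    filter_upwards [self_mem_nhdsWithin] with s (hs : 1 < s)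
    simp only [Function.comp]
    rw [mul_pow, Real.sq_sqrt (by linarith), norm_mul, mul_assoc, mul_assoc]
    have e : ‖(s:ℂ) - 1‖ = s - 1 := by
      rw [show (s:ℂ) - 1 = ((s - 1 : ℝ):ℂ) by push_cast; rfl, Complex.norm_real, Real.norm_of_nonneg (by linarith)]
    rw [e]
    exact mul_le_mul_of_nonneg_left (global_ineq s hs) (by linarith))
  have hne := DirichletCharacter.LFunction_apply_one_ne_zero chi8_ne
  have hpos := norm_pos_iff.2 hne
  simp at this
  exact hne this

end partG

section partH
open Filter Asymptotics MeasureTheory Set Topology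


lemma DS_lim (C : ℝ) (h : Tendsto (fun s : ℝ => √(s - 1) * ((1 + (2:ℝ) ^ (-s)) * DS s)) (𝓝[>] 1) (𝓝 (√Real.pi * C))) :
    Tendsto (fun δ : ℝ => √δ * DS (1 + δ)) (𝓝[>] 0) (𝓝 (√Real.pi * C / (3 / 2))) := by
  have hsh : Tendsto (fun δ : ℝ => 1 + δ) (𝓝[>] 0) (𝓝[>] 1) := by
    apply tendsto_nhdsWithin_of_tendsto_nhds_of_eventually_within
    · have : Tendsto (fun δ : ℝ => 1 + δ) (𝓝 0) (𝓝 (1 + 0)) := (by fun_prop : Continuous (fun δ : ℝ => 1 + δ)).tendsto 0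
      rw [add_zero] at this
      exact this.mono_left nhdsWithin_le_nhds
    · filter_upwards [self_mem_nhdsWithin] with δ (hδ : 0 < δ)
      show 1 < 1 + δ
      linarith
  have h2 : Tendsto (fun s : ℝ => 1 + (2:ℝ) ^ (-s)) (𝓝[>] 1) (𝓝 (3 / 2)) := by
    have : Tendsto (fun s : ℝ => 1 + (2:ℝ) ^ (-s)) (𝓝 1) (𝓝 (1 + (2:ℝ) ^ (-(1:ℝ)))) := by
      apply Continuous.tendsto
      exact continuous_const.add (continuous_const.rpow continuous_neg (fun _ => Or.inl (by norm_num)))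
    have e : 1 + (2:ℝ) ^ (-(1:ℝ)) = 3 / 2 := by rw [Real.rpow_neg_one]; norm_num
    rw [e] at this
    exact this.mono_left nhdsWithin_le_nhds
  have h3 := (h.div h2 (by norm_num)).comp hsh
  refine h3.congr' ?_
  filter_upwards with δ
  simp only [Function.comp, Pi.div_apply]
  have : 0 < 1 + (2:ℝ) ^ (-(1 + δ)) := by positivity
  rw [add_sub_cancel_left]
  field_simp

lemma L_lim (C : ℝ) (h : Tendsto (fun s : ℝ => √(s - 1) * ((1 + (2:ℝ) ^ (-s)) * DS s)) (𝓝[>] 1) (𝓝 (√Real.pi * C))) :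
    Tendsto (fun N : ℕ => (∑ n ∈ Finset.Icc 1 N, fI n / n) / √(Real.log N)) atTop (𝓝 (4 / 3 * C)) := by
  have e : ∀ δ : ℝ, (fun n : ℕ => fI n / n * (n:ℝ) ^ (-δ)) = fun n : ℕ => fI n * (n:ℝ) ^ (-(1 + δ)) := by
    intro δ
    ext n
    rcases Nat.eq_zero_or_pos n with rfl | hn
    · simp [fI_zero]
    · have hn' : (0:ℝ) < n := by exact_mod_cast hn
      rw [neg_add, Real.rpow_add hn', Real.rpow_neg_one]; ring
  have k := karamata (a := fun n : ℕ => fI n / n) (c := √Real.pi * C / (3 / 2))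
    (fun n => div_nonneg (fI_nonneg n) (by positivity)) (by simp)
    (fun δ hδ => by rw [e]; exact DS_summable _ (by linarith))
    (by
      refine (DS_lim C h).congr' ?_
      filter_upwards with δ
      rw [e]; rfl)
  convert k using 2
  have : 0 < √Real.pi := Real.sqrt_pos.2 Real.pi_pos
  field_simp
  ring

lemma fI_odd (n : ℕ) (h : fI n ≠ 0) : n % 2 = 1 := by
  by_contra h'
  apply h
  unfold fI
  rw [if_neg]
  intro hg
  have := hg.2 2 Nat.prime_two (by omega)
  rw [jac_iff 2 Nat.prime_two] at this
  omega

lemma Acount_eq (X : ℝ) : 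
    (Acount X : ℝ) = ((∑ n ∈ Finset.Icc 1 ⌊X / 2⌋₊, fI n * 1) - ∑ n ∈ Finset.Icc 1 ⌊X / 2⌋₊, fI n * chi4 n) / 2 := by
  classical
  have hset : {d : ℕ | Squarefree d ∧ d % 4 = 3 ∧ 1 < 2 * d ∧ (2 * d : ℝ) ≤ X ∧
    ∀ p : ℕ, p.Prime → p ∣ d → jacobiSym 2 p = 1} = ↑((Finset.Icc 1 ⌊X / 2⌋₊).filter (fun d => goodN d ∧ d % 4 = 3)) := by
    ext d
    simp only [Set.mem_ofPred_eq, Finset.coe_filter, Finset.mem_Icc]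
    unfold goodN
    constructor
    · rintro ⟨h1, h2, h3, h4, h5⟩
      exact ⟨⟨by omega, Nat.le_floor (by linarith)⟩, ⟨h1, h5⟩, h2⟩
    · rintro ⟨⟨h1, h2⟩, ⟨h3, h4⟩, h5⟩
      have := (Nat.le_floor_iff' (by omega)).1 h2
      exact ⟨h3, h5, by omega, by linarith, h4⟩
  unfold Acount
  rw [hset, Nat.card_coe_set_eq, Set.ncard_coe_finset, Finset.card_filter, ← Finset.sum_sub_distrib, Finset.sum_div]
  push_cast
  apply Finset.sum_congr rfl
  intro n _
  by_cases hg : goodN n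
  · have hf : fI n = 1 := by unfold fI; rw [if_pos hg]
    have ho := fI_odd n (by rw [hf]; norm_num)
    have ho2 : ¬ n % 2 = 0 := by omega
    by_cases h3 : n % 4 = 3
    · rw [hf, chi4_val]
      simp [hg, h3, ho2]
    · have h1 : n % 4 = 1 := by omega
      rw [hf, chi4_val]
      simp [hg, h1, ho2]
  · have hf : fI n = 0 := by unfold fI; rw [if_neg hg]
    rw [hf, if_neg (fun h => hg h.1)]; norm_num

lemma diff_lim (C : ℝ) (h : Tendsto (fun s : ℝ => √(s - 1) * ((1 + (2:ℝ) ^ (-s)) * DS s)) (𝓝[>] 1) (𝓝 (√Real.pi * C))) :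
    Tendsto (fun N : ℕ => ((∑ n ∈ Finset.Icc 1 N, fI n * 1) - ∑ n ∈ Finset.Icc 1 N, fI n * chi4 n) / 2 * √(Real.log N) / N) atTop
      (𝓝 (C / 3)) := by
  have hL := L_lim C h
  have w1 := wirsing (fun _ => 1) (by simp) (by simp) ((1 + 1) / 4) ((1 + 1) / 4 * (4 / 3 * C)) _
    (Th_tendsto _ 1 1 (by simp) (by simp)) hL (by
      refine (hL.const_mul ((1 + 1) / 4)).congr' ?_
      filter_upwards with N
      simp only [mul_one]
      ring)
  have w2 := wirsing chi4 (by
      intro n; rw [chi4_val]; split_ifs <;> norm_num) (by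
      intro m n
      unfold chi4
      push_cast
      rw [map_mul]; push_cast; rfl) ((1 + -1) / 4) 0 _
    (Th_tendsto _ 1 (-1) (by intro n hn; rw [chi4_val, if_neg (by omega), if_pos (by omega)]) 
      (by intro n hn; rw [chi4_val, if_neg (by omega), if_neg (by omega)])) hL (by simp)
  have := (w1.sub w2).div_const 2
  convert this using 1
  · ext N; ring
  · congr 1; ring

theorem stmt9_aux (C₂ : ℝ)
    (hC : Tendsto
      (fun s : ℝ => Real.sqrt (s - 1) *
        ∏' p : {p : ℕ // p.Prime ∧ (p = 2 ∨ jacobiSym 2 p = 1)}, (1 + (p.1 : ℝ) ^ (-s)))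
      (nhdsWithin 1 (Set.Ioi 1)) (nhds (Real.sqrt Real.pi * C₂))) :
    (fun X : ℝ => (Acount X : ℝ)) ~[atTop]
      fun X : ℝ => (C₂ / 6) * X / Real.sqrt (Real.log X) := by
  have h : Tendsto (fun s : ℝ => √(s - 1) * ((1 + (2:ℝ) ^ (-s)) * DS s)) (𝓝[>] 1) (𝓝 (√Real.pi * C₂)) := by
    refine hC.congr' ?_
    filter_upwards [self_mem_nhdsWithin] with s (hs : 1 < s)
    rw [ES_tprod s hs]
  have hC0 : C₂ ≠ 0 := fun h0 => C_ne_zero _ h (by rw [h0, mul_zero])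
  have hfl : Tendsto (fun X : ℝ => ⌊X / 2⌋₊) atTop atTop :=
    tendsto_nat_floor_atTop.comp (tendsto_id.atTop_div_const (by norm_num))
  have hd := (diff_lim C₂ h).comp hfl
  -- floor over X/2
  have h1 : Tendsto (fun X : ℝ => (⌊X / 2⌋₊ : ℝ) / (X / 2)) atTop (𝓝 1) :=
    (tendsto_nat_floor_div_atTop (R := ℝ)).comp (tendsto_id.atTop_div_const (by norm_num))
  have hlog : Tendsto Real.log atTop atTop := Real.tendsto_log_atTop
  have h2 : Tendsto (fun X : ℝ => Real.log (⌊X / 2⌋₊ : ℝ) / Real.log X) atTop (𝓝 1) := by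
    have a : Tendsto (fun X : ℝ => Real.log ((⌊X / 2⌋₊ : ℝ) / (X / 2)) / Real.log X) atTop (𝓝 0) := by
      have := (Real.continuousAt_log one_ne_zero).tendsto.comp h1
      exact this.div_atTop hlog
    have b : Tendsto (fun X : ℝ => Real.log 2 / Real.log X) atTop (𝓝 0) := tendsto_const_nhds.div_atTop hlog
    have := (a.sub b).const_add 1
    rw [sub_zero, add_zero] at this
    refine this.congr' ?_
    filter_upwards [eventually_ge_atTop 4] with X hX
    have hl : 0 < Real.log X := Real.log_pos (by linarith)
    have hf : 0 < ⌊X / 2⌋₊ := Nat.floor_pos.2 (by linarith)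
    have hf' : (0:ℝ) < ⌊X / 2⌋₊ := by exact_mod_cast hf
    rw [Real.log_div hf'.ne' (by linarith), Real.log_div (by linarith) (by norm_num)]
    field_simp
    ring
  have h3 := (h2.sqrt)
  rw [Real.sqrt_one] at h3
  have h4 := (hd.mul h1).div h3 one_ne_zero
  have h5 := h4.mul_const (3 / C₂)
  apply isEquivalent_of_tendsto_one
  have e : C₂ / 3 * 1 / 1 * (3 / C₂) = 1 := by field_simp
  rw [e] at h5
  refine h5.congr' ?_
  filter_upwards [eventually_ge_atTop 4] with X hX
  have hl : 0 < Real.log X := Real.log_pos (by linarith)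
  have hf : 2 ≤ ⌊X / 2⌋₊ := Nat.le_floor (by push_cast; linarith)
  have hf' : (2:ℝ) ≤ ⌊X / 2⌋₊ := by exact_mod_cast hf
  have hl' : 0 < Real.log (⌊X / 2⌋₊ : ℝ) := Real.log_pos (by linarith)
  simp only [Function.comp, Pi.div_apply]
  rw [← Acount_eq, Real.sqrt_div hl'.le]
  have s1 := Real.sqrt_pos.2 hl
  have s2 := Real.sqrt_pos.2 hl'
  have hX0 : 0 < X := by linarith
  have hf0 : (0:ℝ) < ⌊X / 2⌋₊ := by linarith
  field_simp
  ring

end partH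

/-- `A(X; 3, 4) ~ (C₂/6)·X/√(log X)` as `X → ∞`, where
`C₂ = π^{-1/2} lim_{s→1⁺} √(s-1) ∏_{p ∈ P₂} (1 + p^{-s})` and `P₂` is the set of primes
`p` with `p = 2` or `(2/p) = 1`. -/
theorem stmt9 (C₂ : ℝ)
    (hC : Tendsto
      (fun s : ℝ => Real.sqrt (s - 1) *
        ∏' p : {p : ℕ // p.Prime ∧ (p = 2 ∨ jacobiSym 2 p = 1)}, (1 + (p.1 : ℝ) ^ (-s)))
      (nhdsWithin 1 (Set.Ioi 1)) (nhds (Real.sqrt Real.pi * C₂))) :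
    (fun X : ℝ => (Acount X : ℝ)) ~[atTop]
      fun X : ℝ => (C₂ / 6) * X / Real.sqrt (Real.log X) := by
  exact stmt9_aux C₂ hC
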